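/- arXiv:1403.5430 — 5 statements merged into one kernel-verified Lean document; each statement's English description precedes it below -/
import Mathlib

section
/- Let k ≥ 2 and let G be a finite simple graph of order n whose average degree 2·e(G)/n is strictly greater than k−2. Then G contains a path on k vertices as a subgraph, i.e., there is an injective graph homomorphism from the path graph on k vertices into G. -/
open SimpleGraph

namespace SimpleGraph

variable {V : Type*} {G : SimpleGraph V}

/-- `p` lists, in order, the vertices of a path of `G` inside `S`. -/
def IsPathList (G : SimpleGraph V) (S : Finset V) (p : List V) : Prop :=
  p.IsChain G.Adj ∧ p.Nodup ∧ ∀ x ∈ p, x ∈ S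

lemma IsPathList.reverse {S : Finset V} {p : List V} (hp : G.IsPathList S p) :
    G.IsPathList S p.reverse := by
  refine ⟨?_, List.nodup_reverse.2 hp.2.1, fun x hx => hp.2.2 x (List.mem_reverse.1 hx)⟩
  rw [List.isChain_reverse]
  exact hp.1.imp fun _ _ h => h.symm

lemma IsPathList.take {S : Finset V} {p : List V} (hp : G.IsPathList S p) (n : ℕ) :
    G.IsPathList S (p.take n) :=
  ⟨hp.1.take n, hp.2.1.sublist (List.take_sublist n p),
    fun x hx => hp.2.2 x (List.mem_of_mem_take hx)⟩

/-- `p` is a longest path of `G` inside `S`. -/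
def IsLongestPathList (G : SimpleGraph V) (S : Finset V) (p : List V) : Prop :=
  G.IsPathList S p ∧ ∀ q, G.IsPathList S q → q.length ≤ p.length

lemma IsLongestPathList.reverse {S : Finset V} {p : List V} (hp : G.IsLongestPathList S p) :
    G.IsLongestPathList S p.reverse :=
  ⟨hp.1.reverse, fun q hq => by simpa using hp.2 q hq⟩

lemma exists_isLongestPathList (G : SimpleGraph V) {S : Finset V} (hS : S.Nonempty) :
    ∃ p, G.IsLongestPathList S p ∧ p ≠ [] := by
  classical
  obtain ⟨v, hv⟩ := hS
  have hsingle : G.IsPathList S [v] := ⟨by simp, by simp, by simpa using hv⟩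
  have hbound : ∀ p, G.IsPathList S p → p.length ≤ S.card := fun p hp => by
    rw [← List.toFinset_card_of_nodup hp.2.1]
    exact Finset.card_le_card fun x hx => hp.2.2 x (List.mem_toFinset.1 hx)
  let Q : ℕ → Prop := fun n => ∃ p, G.IsPathList S p ∧ p.length = n
  have h1 : Q 1 := ⟨[v], hsingle, rfl⟩
  have hcard : 1 ≤ S.card := hbound _ hsingle
  obtain ⟨p, hp, hlen⟩ := Nat.findGreatest_spec (P := Q) hcard h1
  have hmax : ∀ q, G.IsPathList S q → q.length ≤ p.length := fun q hq => by
    rw [hlen]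
    exact Nat.le_findGreatest (hbound q hq) ⟨q, hq, rfl⟩
  refine ⟨p, ⟨hp, hmax⟩, ?_⟩
  rintro rfl
  simpa using hmax _ hsingle

/-- The neighbours of the first vertex of a longest path lie on the path. -/
lemma IsLongestPathList.mem_of_adj_head {S : Finset V} {p : List V}
    (hp : G.IsLongestPathList S p) {x : V} (hx : x ∈ S) (h : ∀ y ∈ p.head?, G.Adj x y) :
    x ∈ p := by
  by_contra hxp
  have := hp.2 (x :: p) ⟨hp.1.1.cons h, List.nodup_cons.2 ⟨hxp, hp.1.2.1⟩, by
    simpa [hx] using hp.1.2.2⟩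
  simp at this

/-- If the ends of a longest path are adjacent, then no edge leaves its vertex set. -/
lemma IsLongestPathList.mem_of_adj_of_closed {S : Finset V} {p : List V}
    (hp : G.IsLongestPathList S p) (hc : ∀ a ∈ p.getLast?, ∀ b ∈ p.head?, G.Adj a b)
    {x y : V} (hx : x ∈ S) (hy : y ∈ p) (hxy : G.Adj x y) : x ∈ p := by
  obtain ⟨D, E, rfl⟩ := List.append_of_mem hy
  have hperm : ((y :: E) ++ D).Perm (D ++ y :: E) := List.perm_append_comm
  have hrot : G.IsLongestPathList S ((y :: E) ++ D) := by
    refine ⟨⟨?_, hperm.nodup_iff.2 hp.1.2.1, fun z hz => hp.1.2.2 z (hperm.mem_iff.1 hz)⟩,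
      fun q hq => hperm.length_eq ▸ hp.2 q hq⟩
    obtain ⟨h1, h2, -⟩ := List.isChain_append.1 hp.1.1
    refine List.isChain_append.2 ⟨h2, h1, fun a ha b hb => hc a ?_ b ?_⟩
    · rw [List.getLast?_append]; simp_all
    · rw [List.head?_append]; simp_all
  exact hperm.mem_iff.1 (hrot.mem_of_adj_head hx (by simpa using hxy))

/-- Crossing chords at the ends of a longest path close it up to a cycle, so that no edge
leaves its vertex set. -/
lemma IsLongestPathList.mem_of_adj_of_crossing {S : Finset V} {p : List V}
    (hp : G.IsLongestPathList S p) {i : ℕ} (hi : i + 1 < p.length)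
    (h0 : G.Adj p[0] p[i + 1]) (h1 : G.Adj p[p.length - 1] p[i])
    {x y : V} (hx : x ∈ S) (hy : y ∈ p) (hxy : G.Adj x y) : x ∈ p := by
  have hperm : (p.take (i + 1) ++ (p.drop (i + 1)).reverse).Perm p := by
    conv_rhs => rw [← List.take_append_drop (i + 1) p]
    exact (List.reverse_perm _).append_left _
  have hlast : (p.take (i + 1)).getLast? = some p[i] := by
    rw [List.getLast?_eq_getElem?]
    simp [Nat.min_eq_left hi.le]
  have hdlast : (p.drop (i + 1)).getLast? = some p[p.length - 1] := by
    rw [List.getLast?_drop, if_neg (by omega), List.getLast?_eq_getElem?,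
      List.getElem?_eq_getElem]
  have hdhead : (p.drop (i + 1)).head? = some p[i + 1] := by
    rw [List.head?_drop, List.getElem?_eq_getElem hi]
  have hthead : (p.take (i + 1)).head? = some p[0] := by
    rw [List.head?_take, if_neg (by omega), List.head?_eq_getElem?, List.getElem?_eq_getElem]
  have hrev : (p.drop (i + 1)).reverse.IsChain G.Adj := by
    rw [List.isChain_reverse]
    exact (hp.1.1.drop _).imp fun _ _ h => h.symm
  have hcyc : G.IsLongestPathList S (p.take (i + 1) ++ (p.drop (i + 1)).reverse) := by
    refine ⟨⟨List.isChain_append.2 ⟨hp.1.1.take _, hrev, ?_⟩, hperm.nodup_iff.2 hp.1.2.1,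
      fun z hz => hp.1.2.2 z (hperm.mem_iff.1 hz)⟩, fun q hq => hperm.length_eq ▸ hp.2 q hq⟩
    intro a ha b hb
    rw [hlast, Option.mem_some] at ha
    rw [List.head?_reverse, hdlast, Option.mem_some] at hb
    exact ha ▸ hb ▸ h1.symm
  refine hperm.mem_iff.1 (hcyc.mem_of_adj_of_closed ?_ hx (hperm.mem_iff.2 hy) hxy)
  intro a ha b hb
  rw [List.getLast?_append, List.getLast?_reverse, hdhead, Option.some_or,
    Option.mem_some] at ha
  rw [List.head?_append, hthead, Option.some_or, Option.mem_some] at hb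
  exact ha ▸ hb ▸ h0.symm

/-- Either no edge leaves the vertex set of a longest path, or the degrees of its ends add up
to less than its number of vertices. -/
lemma IsLongestPathList.closed_or_card_add_card_lt [DecidableRel G.Adj] {S : Finset V}
    {p : List V} (hp : G.IsLongestPathList S p) (hpos : 0 < p.length) :
    (∀ x ∈ S, ∀ y ∈ p, G.Adj x y → x ∈ p) ∨
      (S.filter (G.Adj p[0])).card + (S.filter (G.Adj p[p.length - 1])).card < p.length := by
  classical
  refine or_iff_not_imp_left.2 fun hopen => ?_
  let A : Finset (Fin (p.length - 1)) :=
    Finset.univ.filter fun i => G.Adj p[0] (p[i.1 + 1]'(by omega))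
  let B : Finset (Fin (p.length - 1)) :=
    Finset.univ.filter fun i => G.Adj p[p.length - 1] (p[i.1]'(by omega))
  have hA : (S.filter (G.Adj p[0])).card ≤ A.card := by
    refine (Finset.card_le_card (t := A.image fun i => p[i.1 + 1]'(by omega)) ?_).trans
      Finset.card_image_le
    intro x hx
    obtain ⟨hxS, hadj⟩ := Finset.mem_filter.1 hx
    have hxp := hp.mem_of_adj_head hxS (by
      simpa [List.head?_eq_getElem?, List.getElem?_eq_getElem hpos] using hadj.symm)
    obtain ⟨j, hj, rfl⟩ := List.getElem_of_mem hxp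
    obtain _ | j := j
    · exact absurd hadj (G.irrefl)
    · exact Finset.mem_image.2 ⟨⟨j, by omega⟩, by simpa [A] using hadj, rfl⟩
  have hB : (S.filter (G.Adj p[p.length - 1])).card ≤ B.card := by
    refine (Finset.card_le_card (t := B.image fun i => p[i.1]'(by omega)) ?_).trans
      Finset.card_image_le
    intro x hx
    obtain ⟨hxS, hadj⟩ := Finset.mem_filter.1 hx
    have hxp := List.mem_reverse.1 (hp.reverse.mem_of_adj_head hxS (by
      simpa [List.getLast?_eq_getElem?, List.getElem?_eq_getElem (Nat.sub_lt hpos one_pos)]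
        using hadj.symm))
    obtain ⟨j, hj, rfl⟩ := List.getElem_of_mem hxp
    have hne : j ≠ p.length - 1 := by
      rintro rfl
      exact G.irrefl hadj
    exact Finset.mem_image.2 ⟨⟨j, by omega⟩, by simpa [B] using hadj, rfl⟩
  have hdisj : Disjoint A B := Finset.disjoint_left.2 fun i hiA hiB => hopen
    fun x hx y hy hxy => hp.mem_of_adj_of_crossing (i := i.1) (by omega)
      (by simpa [A] using hiA) (by simpa [B] using hiB) hx hy hxy
  have hcard : (A ∪ B).card ≤ p.length - 1 := by
    simpa using Finset.card_le_univ (A ∪ B)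
  rw [Finset.card_union_of_disjoint hdisj] at hcard
  omega

lemma sum_card_filter_adj_eq_erase_add [DecidableEq V] [DecidableRel G.Adj] {S : Finset V}
    {v : V} (hv : v ∈ S) :
    ∑ w ∈ S, (S.filter (G.Adj w)).card =
      ∑ w ∈ S.erase v, ((S.erase v).filter (G.Adj w)).card + 2 * (S.filter (G.Adj v)).card := by
  have hsplit : ∀ w ∈ S.erase v, (S.filter (G.Adj w)).card =
      ((S.erase v).filter (G.Adj w)).card + if G.Adj v w then 1 else 0 := fun w _ => by
    simp only [Finset.card_filter, ← Finset.add_sum_erase S _ hv, G.adj_comm w v]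
    ring
  rw [← Finset.add_sum_erase S _ hv, Finset.sum_congr rfl hsplit, Finset.sum_add_distrib,
    ← Finset.card_filter, Finset.filter_erase,
    Finset.erase_eq_of_notMem (s := S.filter (G.Adj v)) (by simp)]
  ring

lemma sum_card_filter_adj_le_of_closed [DecidableEq V] [DecidableRel G.Adj] {S T : Finset V}
    (hTS : T ⊆ S) (hT : ∀ x ∈ S, ∀ y ∈ T, G.Adj x y → x ∈ T) :
    ∑ w ∈ S, (S.filter (G.Adj w)).card ≤
      ∑ w ∈ S \ T, ((S \ T).filter (G.Adj w)).card + (T.card - 1) * T.card := by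
  rw [← Finset.sum_sdiff hTS]
  refine add_le_add (Finset.sum_le_sum fun w hw => Finset.card_le_card fun x hx => ?_) ?_
  · simp only [Finset.mem_filter, Finset.mem_sdiff] at hx hw ⊢
    exact ⟨⟨hx.1, fun hxT => hw.2 (hT w hw.1 x hxT hx.2)⟩, hx.2⟩
  · rw [mul_comm, ← smul_eq_mul]
    refine Finset.sum_le_card_nsmul _ _ _ fun w hw => ?_
    rw [← Finset.card_erase_of_mem hw]
    refine Finset.card_le_card fun x hx => ?_
    simp only [Finset.mem_filter, Finset.mem_erase] at hx ⊢
    exact ⟨hx.2.ne', hT x hx.1 w hw hx.2.symm⟩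

/-- If `G` has no path on `c + 2` vertices inside `S`, then the degrees in the subgraph
induced by `S` are at most `c` on average. -/
theorem sum_card_filter_adj_le [DecidableRel G.Adj] {c : ℕ} (S : Finset V)
    (h : ∀ p, G.IsPathList S p → p.length ≠ c + 2) :
    ∑ v ∈ S, (S.filter (G.Adj v)).card ≤ c * S.card := by
  classical
  induction S using Finset.strongInduction with
  | H S ih =>
  obtain rfl | hS := S.eq_empty_or_nonempty
  · simp
  have ih' : ∀ T ⊂ S, ∑ v ∈ T, (T.filter (G.Adj v)).card ≤ c * T.card := fun T hT =>
    ih T hT fun p hp => h p ⟨hp.1, hp.2.1, fun x hx => hT.1 (hp.2.2 x hx)⟩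
  obtain ⟨p, hp, hne⟩ := G.exists_isLongestPathList hS
  have hpos : 0 < p.length := List.length_pos_iff.2 hne
  have hlen : p.length ≤ c + 1 := by
    by_contra! hlt
    exact h _ (hp.1.take (c + 2)) (by simp; omega)
  have herase : ∀ v ∈ S, 2 * (S.filter (G.Adj v)).card ≤ c →
      ∑ v ∈ S, (S.filter (G.Adj v)).card ≤ c * S.card := fun v hv hdeg => by
    rw [sum_card_filter_adj_eq_erase_add hv, ← Finset.card_erase_add_one hv, mul_add_one]
    exact add_le_add (ih' _ (Finset.erase_ssubset hv)) hdeg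
  obtain hclosed | hdeg := hp.closed_or_card_add_card_lt hpos
  · have hTS : p.toFinset ⊆ S := fun x hx => hp.1.2.2 x (List.mem_toFinset.1 hx)
    have hTne : p.toFinset.Nonempty := by simpa using hne
    have hTcard : p.toFinset.card - 1 ≤ c := by
      rw [List.toFinset_card_of_nodup hp.1.2.1]
      omega
    calc _ ≤ _ := sum_card_filter_adj_le_of_closed hTS (by simpa using hclosed)
      _ ≤ c * (S \ p.toFinset).card + c * p.toFinset.card :=
        add_le_add (ih' _ (Finset.sdiff_ssubset hTS hTne)) (Nat.mul_le_mul_right _ hTcard)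
      _ = c * S.card := by rw [← mul_add, Finset.card_sdiff_add_card_eq_card hTS]
  · obtain h0 | h1 : 2 * (S.filter (G.Adj p[0])).card ≤ c ∨
        2 * (S.filter (G.Adj p[p.length - 1])).card ≤ c := by omega
    · exact herase _ (hp.1.2.2 _ (List.getElem_mem _)) h0
    · exact herase _ (hp.1.2.2 _ (List.getElem_mem _)) h1

lemma IsPathList.exists_pathGraph_hom {S : Finset V} {p : List V} (hp : G.IsPathList S p) :
    ∃ f : pathGraph p.length →g G, Function.Injective f := by
  refine ⟨⟨fun i => p[i], ?_⟩, fun i j hij => Fin.ext ((hp.2.1.getElem_inj_iff).1 hij)⟩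
  intro i j hij
  have hchain := List.isChain_iff_getElem.1 hp.1
  obtain hij | hij := pathGraph_adj.1 hij
  · have := hchain i.1 (by omega)
    simpa [hij] using this
  · have := hchain j.1 (by omega)
    simpa [hij] using this.symm

end SimpleGraph

/-- Erdős–Gallai (1959): a graph with average degree more than `k - 2`
contains a path on `k` vertices. -/
theorem erdos_gallai_path {V : Type*} [Fintype V] (G : SimpleGraph V) [DecidableRel G.Adj]
    (k : ℕ) (hk : 2 ≤ k)
    (havg : (k : ℝ) - 2 < 2 * G.edgeFinset.card / Fintype.card V) :
    ∃ f : pathGraph k →g G, Function.Injective f := by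
  obtain ⟨c, rfl⟩ := Nat.exists_eq_add_of_le' hk
  by_contra hno
  have hle := sum_card_filter_adj_le (G := G) (c := c) Finset.univ fun p hp hlen =>
    hno (hlen ▸ hp.exists_pathGraph_hom)
  have hdeg : ∑ v, (Finset.univ.filter (G.Adj v)).card = 2 * G.edgeFinset.card := by
    rw [← G.sum_degrees_eq_twice_card_edges]
    exact Finset.sum_congr rfl fun v _ => by rw [← card_neighborFinset_eq_degree,
      neighborFinset_eq_filter]
  rw [hdeg, Finset.card_univ] at hle
  refine absurd havg (not_lt.2 ?_)
  push_cast
  rw [add_sub_cancel_right]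
  exact div_le_of_le_mul₀ (by positivity) (by positivity) (by exact_mod_cast hle)
end

section
/- Let k ≥ 2 and let G be a finite simple graph of order n with girth at least 5 whose average degree 2·e(G)/n is strictly greater than k−2. Then G contains every tree of order k as a subgraph. -/
open SimpleGraph

namespace SimpleGraph

variable {V W : Type*} {G : SimpleGraph V} {T : SimpleGraph W}

lemma not_adj_of_four_le_egirth (h : 4 ≤ G.egirth) {a b c : V}
    (hab : G.Adj a b) (hbc : G.Adj b c) : ¬ G.Adj c a := by
  intro hca
  have hc : (Walk.cons hab (Walk.cons hbc (Walk.cons hca Walk.nil))).IsCycle := by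
    rw [Walk.cons_isCycle_iff]
    simp [Walk.cons_isPath_iff, hab.ne, hab.ne', hbc.ne, hca.ne, hca.ne']
  have := le_egirth.mp h _ _ hc
  simp only [Walk.length_cons, Walk.length_nil] at this
  norm_num at this

lemma eq_of_common_neighbors_of_five_le_egirth (h : 5 ≤ G.egirth) {a b c d : V} (hac : a ≠ c)
    (hab : G.Adj a b) (hbc : G.Adj b c) (hcd : G.Adj c d) (hda : G.Adj d a) : b = d := by
  by_contra hbd
  have hc : (Walk.cons hab (Walk.cons hbc (Walk.cons hcd (Walk.cons hda Walk.nil)))).IsCycle := by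
    rw [Walk.cons_isCycle_iff]
    simp [Walk.cons_isPath_iff, hab.ne, hab.ne', hbc.ne, hcd.ne, hda.ne,
      hda.ne', hac, hac.symm, hbd]
  have := le_egirth.mp h _ _ hc
  simp only [Walk.length_cons, Walk.length_nil] at this
  norm_num at this

/-- In a forest, a vertex outside a connected set has at most one neighbour in it. -/
lemma IsAcyclic.eq_of_adj_of_induce_preconnected (hT : T.IsAcyclic) {U : Set W}
    (hU : (T.induce U).Preconnected) {z p q : W} (hz : z ∉ U) (hp : p ∈ U) (hq : q ∈ U)
    (hzp : T.Adj z p) (hzq : T.Adj z q) : p = q := by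
  classical
  by_contra hpq
  obtain ⟨r, hr⟩ := (hU ⟨p, hp⟩ ⟨q, hq⟩).exists_isPath
  have hr' : (r.map (Embedding.induce (G := T) U).toHom).IsPath :=
    hr.map (Embedding.induce (G := T) U).injective
  have hs : (Walk.cons hzp.symm (Walk.cons hzq Walk.nil)).IsPath := by
    simp [Walk.cons_isPath_iff, hzp.ne', hzq.ne, hpq]
  have heq : r.map (Embedding.induce (G := T) U).toHom = .cons hzp.symm (.cons hzq .nil) :=
    congrArg Subtype.val ((hT.subsingleton_path p q).elim ⟨_, hr'⟩ ⟨_, hs⟩)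
  have hmem : z ∈ (r.map (Embedding.induce (G := T) U).toHom).support := by
    rw [heq]; simp
  rw [Walk.support_map, List.mem_map] at hmem
  obtain ⟨a, -, rfl⟩ := hmem
  exact hz a.2

lemma induce_insert_preconnected {U : Set W} (hU : (T.induce U).Preconnected) {y w : W}
    (hy : y ∈ U) (hyw : T.Adj y w) : (T.induce (insert w U)).Preconnected := by
  have h := induce_union_connected hU (induce_pair_connected_of_adj hyw).preconnected
    ⟨y, hy, by simp⟩
  have hset : U ∪ {y, w} = insert w U := by
    ext a; simp only [Set.mem_union, Set.mem_insert_iff, Set.mem_singleton_iff]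
    constructor
    · rintro (h | rfl | h) <;> simp_all
    · rintro (h | h) <;> simp_all
  rw [← hset]
  exact h.preconnected

lemma Preconnected.exists_adj_notMem (hT : T.Preconnected) {U : Set W} {x z : W} (hx : x ∈ U)
    (hz : z ∉ U) : ∃ y ∈ U, ∃ w ∉ U, T.Adj y w := by
  obtain ⟨r⟩ := hT x z
  obtain ⟨d, -, h1, h2⟩ := r.exists_boundary_dart U hx hz
  exact ⟨_, h1, _, h2, d.adj⟩

/-- `f` restricts to an injective homomorphism from `T` induced on `U` to `G`. -/
def IsPartialCopy (T : SimpleGraph W) (G : SimpleGraph V) (U : Finset W) (f : W → V) : Prop :=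
  Set.InjOn f U ∧ ∀ a ∈ U, ∀ b ∈ U, T.Adj a b → G.Adj (f a) (f b)

/-- A partial copy extends to a new vertex `w` attached at `y` when `f y` has more neighbours in
`S` than in the image of the copy. -/
lemma IsPartialCopy.exists_extend [DecidableEq W] [DecidableRel G.Adj] {U : Finset W} {f : W → V}
    {S : Finset V} (hf : IsPartialCopy T G U f) (hfS : ∀ a ∈ U, f a ∈ S) {y w : W} (hw : w ∉ U)
    (huniq : ∀ a ∈ U, T.Adj w a → a = y)
    (hcard : (U.filter fun p ↦ G.Adj (f y) (f p)).card < (S.filter (G.Adj (f y))).card) :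
    ∃ g : W → V, IsPartialCopy T G (insert w U) g ∧ (∀ a ∈ insert w U, g a ∈ S) ∧
      ∀ a ∈ U, g a = f a := by
  classical
  obtain ⟨s, hs, hsn⟩ := Finset.exists_mem_notMem_of_card_lt_card
    (Finset.card_image_le.trans_lt hcard : ((U.filter fun p ↦ G.Adj (f y) (f p)).image f).card < _)
  rw [Finset.mem_filter] at hs
  have hsU : ∀ a ∈ U, f a ≠ s := by
    rintro a ha rfl
    exact hsn (Finset.mem_image_of_mem _ (Finset.mem_filter.2 ⟨ha, hs.2⟩))
  have hg : ∀ a ∈ U, Function.update f w s a = f a := fun a ha ↦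
    Function.update_of_ne (by rintro rfl; exact hw ha) _ _
  have hgw : Function.update f w s w = s := Function.update_self ..
  refine ⟨Function.update f w s, ⟨?_, ?_⟩, ?_, hg⟩
  · intro a ha b hb hab
    simp only [Finset.coe_insert, Set.mem_insert_iff, Finset.mem_coe] at ha hb
    rcases ha with rfl | ha <;> rcases hb with rfl | hb
    · rfl
    · rw [hgw, hg b hb] at hab; exact absurd hab.symm (hsU b hb)
    · rw [hgw, hg a ha] at hab; exact absurd hab (hsU a ha)
    · rw [hg a ha, hg b hb] at hab; exact hf.1 ha hb hab
  · intro a ha b hb hab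
    rw [Finset.mem_insert] at ha hb
    rcases ha with rfl | ha <;> rcases hb with rfl | hb
    · exact absurd hab T.irrefl
    · rw [hgw, hg b hb, huniq b hb hab]; exact hs.2.symm
    · rw [hgw, hg a ha, huniq a ha hab.symm]; exact hs.2
    · rw [hg a ha, hg b hb]; exact hf.2 a ha b hb hab
  · intro a ha
    rcases Finset.mem_insert.1 ha with rfl | ha
    · rw [hgw]; exact hs.1
    · rw [hg a ha]; exact hfS a ha

/-- The leaves of `T` attached at `y`. -/
def leavesAt (T : SimpleGraph W) (y : W) : Set W := {v | T.Adj y v ∧ ∀ z, T.Adj v z → z = y}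

open Classical in
/-- If the leaves at `x`, at least as many as those at `y`, are not yet placed, then `f y` has few
neighbours in a partial copy of the tree `T`. -/
lemma IsPartialCopy.two_mul_card_neighbors_add_two_le [Fintype W] (hG : 5 ≤ G.egirth)
    (hT : T.IsTree) {U : Finset W} {f : W → V} (hf : IsPartialCopy T G U f)
    (hU : (T.induce (U : Set W)).Preconnected) {x y w : W} (hx : x ∈ U) (hy : y ∈ U)
    (hw : w ∉ U) (hyw : T.Adj y w) (hwx : w ∉ T.leavesAt x)
    (hUx : ∀ a ∈ T.leavesAt x, a ∉ U)
    (hle : (T.leavesAt y).toFinset.card ≤ (T.leavesAt x).toFinset.card) :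
    2 * (U.filter fun p ↦ G.Adj (f y) (f p)).card + 2 ≤ Fintype.card W := by
  set P := U.filter fun p ↦ G.Adj (f y) (f p) with hP
  set L := (T.leavesAt x).toFinset with hL
  set B := P.filter (· ∈ T.leavesAt y) with hB
  have hyP : y ∉ P := by simp [hP]
  have huniq : ∀ {z p q}, z ∉ U → p ∈ U → q ∈ U → T.Adj z p → T.Adj z q → p = q :=
    fun hz hp hq ↦ hT.isAcyclic.eq_of_adj_of_induce_preconnected hU
      (by simpa using hz) (by simpa using hp) (by simpa using hq)
  have hex : ∀ p ∈ P \ B, ∃ z, T.Adj p z ∧ z ≠ y := by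
    intro p hp
    by_contra! hcon
    rw [Finset.mem_sdiff] at hp
    have hpy : p ≠ y := by rintro rfl; exact hyP hp.1
    have : Nontrivial W := ⟨p, y, hpy⟩
    obtain ⟨z, hz⟩ := hT.connected.preconnected.exists_adj_of_nontrivial p
    obtain rfl := hcon z hz
    exact hp.2 (Finset.mem_filter.2 ⟨hp.1, hz.symm, hcon⟩)
  choose! g hg hgy using hex
  have hPU : ∀ p ∈ P \ B, p ∈ U ∧ G.Adj (f y) (f p) := fun p hp ↦
    Finset.mem_filter.1 (Finset.mem_sdiff.1 hp).1
  have hginj : Set.InjOn g (P \ B : Finset W) := by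
    intro p hp q hq hpq
    have hp' := hPU p hp
    have hq' := hPU q hq
    by_cases hz : g p ∈ U
    · refine hf.1 hp'.1 hq'.1 ?_
      refine eq_of_common_neighbors_of_five_le_egirth hG (a := f y) (c := f (g p)) ?_ hp'.2
        (hf.2 _ hp'.1 _ hz (hg p hp)) (hf.2 _ hz _ hq'.1 ?_) hq'.2.symm
      · exact fun h ↦ hgy p hp (hf.1 hz hy h.symm)
      · rw [hpq]; exact (hg q hq).symm
    · exact huniq hz hp'.1 hq'.1 (hg p hp).symm (by rw [hpq]; exact (hg q hq).symm)
  have hgP : ∀ p ∈ P \ B, g p ∉ P := by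
    intro p hp hgp
    have hp' := hPU p hp
    have hgp' := Finset.mem_filter.1 hgp
    exact not_adj_of_four_le_egirth (le_trans (by norm_num) hG) hp'.2
      (hf.2 _ hp'.1 _ hgp'.1 (hg p hp)) hgp'.2.symm
  have hgw : ∀ p ∈ P \ B, g p ≠ w := by
    intro p hp h
    have hp' := hPU p hp
    have := huniq hw hp'.1 hy (h ▸ (hg p hp).symm) hyw.symm
    exact G.irrefl (this ▸ hp'.2)
  have hgL : ∀ p ∈ P \ B, g p ∈ L → g p = g x := by
    intro p hp h
    have h' : g p ∈ T.leavesAt x := by simpa [hL] using h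
    rw [← h'.2 p (hg p hp).symm]
  have hwL : w ∉ L := by simpa [hL] using hwx
  have hyL : y ∉ L := fun h ↦ hUx y (by simpa [hL] using h) hy
  have hPL : Disjoint P L := by
    rw [Finset.disjoint_left]
    intro a ha hl
    exact hUx a (by simpa [hL] using hl) (Finset.mem_filter.1 ha).1
  have hwP : w ∉ P := fun h ↦ hw (Finset.mem_filter.1 h).1
  have hywne := hyw.ne
  set I := (P \ B).image g with hI
  have hIcard : I.card + B.card = P.card := by
    rw [hI, Finset.card_image_of_injOn hginj]
    exact Finset.card_sdiff_add_card_eq_card (Finset.filter_subset _ _)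
  have hPI : Disjoint P I := by
    rw [Finset.disjoint_right]
    intro a ha
    obtain ⟨p, hp, rfl⟩ := Finset.mem_image.1 ha
    exact hgP p hp
  have hyI : y ∉ I := by
    intro h
    obtain ⟨p, hp, h⟩ := Finset.mem_image.1 h
    exact hgy p hp h
  have hwI : w ∉ I := by
    intro h
    obtain ⟨p, hp, h⟩ := Finset.mem_image.1 h
    exact hgw p hp h
  have hILsub : I ∩ L ⊆ {g x} := by
    intro a ha
    rw [Finset.mem_inter] at ha
    obtain ⟨p, hp, rfl⟩ := Finset.mem_image.1 ha.1
    exact Finset.mem_singleton.2 (hgL p hp ha.2)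
  have hIL : (I ∪ L).card + 1 ≥ I.card + L.card := by
    have := Finset.card_union_add_card_inter I L
    have := Finset.card_le_card hILsub
    simp only [Finset.card_singleton] at this
    omega
  have hPIL : Disjoint P (I ∪ L) := Finset.disjoint_union_right.2 ⟨hPI, hPL⟩
  have hBsub : B ⊆ (T.leavesAt y).toFinset := by
    intro a ha
    simpa using (Finset.mem_filter.1 ha).2
  by_cases hwl : w ∈ T.leavesAt y
  · have hB' : B.card + 1 ≤ L.card := by
      rw [← Finset.card_insert_of_notMem (fun h ↦ hwP (Finset.mem_filter.1 h).1 : w ∉ B)]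
      refine (Finset.card_le_card (Finset.insert_subset ?_ hBsub)).trans hle
      simpa using hwl
    have hcard : (insert y (insert w (P ∪ (I ∪ L)))).card = P.card + (I ∪ L).card + 2 := by
      rw [Finset.card_insert_of_notMem, Finset.card_insert_of_notMem,
        Finset.card_union_of_disjoint hPIL] <;>
        simp only [Finset.mem_insert, Finset.mem_union, not_or] <;> tauto
    have := Finset.card_le_univ (insert y (insert w (P ∪ (I ∪ L))))
    omega
  · have hB' : B.card ≤ L.card := (Finset.card_le_card hBsub).trans hle
    obtain ⟨v, hwv, hvy⟩ : ∃ v, T.Adj w v ∧ v ≠ y := by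
      by_contra! hcon
      exact hwl ⟨hyw, hcon⟩
    have hvU : v ∉ U := fun h ↦ hvy (huniq hw h hy hwv hyw.symm)
    have hvL : v ∉ L := by
      intro h
      have h' : v ∈ T.leavesAt x := by simpa [hL] using h
      exact hw (h'.2 w hwv.symm ▸ hx)
    have hvP : v ∉ P := fun h ↦ hvU (Finset.mem_filter.1 h).1
    have hvI : v ∉ I := by
      intro h
      obtain ⟨p, hp, h⟩ := Finset.mem_image.1 h
      have hp' := hPU p hp
      have := hT.isAcyclic.eq_of_adj_of_induce_preconnected (z := v) (p := p) (q := w)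
        (induce_insert_preconnected hU (by simpa using hy) hyw)
        (by simp [hvU, hwv.ne']) (by simp [hp'.1]) (by simp)
        (h ▸ (hg p hp).symm) hwv.symm
      exact hw (this ▸ hp'.1)
    have hwvne := hwv.ne
    have hvy' := hvy.symm
    have hcard : (insert y (insert w (insert v (P ∪ (I ∪ L))))).card
        = P.card + (I ∪ L).card + 3 := by
      rw [Finset.card_insert_of_notMem, Finset.card_insert_of_notMem,
        Finset.card_insert_of_notMem, Finset.card_union_of_disjoint hPIL] <;>
        simp only [Finset.mem_insert, Finset.mem_union, not_or] <;> tauto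
    have := Finset.card_le_univ (insert y (insert w (insert v (P ∪ (I ∪ L)))))
    omega

open Classical in
/-- A tree embeds into a vertex set `S` of a graph of girth at least five if every vertex of `S`
has at least `(|T| - 1) / 2` neighbours in `S` and some vertex has at least `|T| - 1`. -/
theorem IsTree.exists_injective_hom_of_five_le_egirth [Fintype W] (hT : T.IsTree)
    (hG : 5 ≤ G.egirth) {S : Finset V}
    (hmin : ∀ v ∈ S, Fintype.card W ≤ 2 * (S.filter (G.Adj v)).card + 1) {v₀ : V} (hv₀ : v₀ ∈ S)
    (hmax : Fintype.card W ≤ (S.filter (G.Adj v₀)).card + 1) :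
    ∃ f : T →g G, Function.Injective f := by
  have := hT.connected.nonempty
  obtain ⟨x, hx⟩ := Finite.exists_max fun y ↦ (T.leavesAt y).toFinset.card
  have hxx : x ∉ T.leavesAt x := fun h ↦ T.irrefl h.1
  let Q : Finset W → Prop := fun U ↦ x ∈ U ∧ (T.induce (U : Set W)).Preconnected ∧
    ((∀ a ∈ T.leavesAt x, a ∉ U) ∨ ∀ a ∉ T.leavesAt x, a ∈ U) ∧
    ∃ f : W → V, IsPartialCopy T G U f ∧ (∀ a ∈ U, f a ∈ S) ∧ f x = v₀
  have hQ : Q {x} := by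
    refine ⟨by simp, ?_, Or.inl ?_, fun _ ↦ v₀, ⟨by simp, by simp⟩, by simpa, rfl⟩
    · rintro ⟨a, ha⟩ ⟨b, hb⟩
      have ha' : a = x := by simpa using ha
      have hb' : b = x := by simpa using hb
      subst ha' hb'
      exact Reachable.refl _
    · intro a ha h
      exact hxx (Finset.mem_singleton.1 h ▸ ha)
  obtain ⟨U, -, hU⟩ := (Set.toFinite {U | Q U}).exists_le_maximal hQ
  obtain ⟨hxU, hconn, hphase, f, hf, hfS, hfx⟩ := hU.prop
  by_cases huniv : U = Finset.univ
  · subst huniv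
    exact ⟨⟨f, fun h ↦ hf.2 _ (Finset.mem_univ _) _ (Finset.mem_univ _) h⟩,
      fun a b h ↦ hf.1 (by simp) (by simp) h⟩
  exfalso
  have key : ∀ y ∈ U, ∀ w ∉ U, T.Adj y w →
      ((∀ a ∈ T.leavesAt x, a ∉ insert w U) ∨ ∀ a ∉ T.leavesAt x, a ∈ insert w U) →
      (U.filter fun p ↦ G.Adj (f y) (f p)).card < (S.filter (G.Adj (f y))).card → False := by
    intro y hy w hw hyw hph hcard
    obtain ⟨g, hg, hgS, hgf⟩ := hf.exists_extend hfS hw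
      (fun a ha hwa ↦ hT.isAcyclic.eq_of_adj_of_induce_preconnected hconn (by simpa using hw)
        (by simpa using ha) (by simpa using hy) hwa hyw.symm) hcard
    have hQ' : Q (insert w U) := ⟨Finset.mem_insert_of_mem hxU,
      by rw [Finset.coe_insert]; exact induce_insert_preconnected hconn (by simpa using hy) hyw,
      hph, g, hg, hgS, (hgf x hxU).trans hfx⟩
    exact hw (hU.le_of_ge hQ' (Finset.subset_insert _ _) (Finset.mem_insert_self _ _))
  have hcardx : (U.filter fun p ↦ G.Adj (f x) (f p)).card < (S.filter (G.Adj (f x))).card := by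
    have h1 : (U.filter fun p ↦ G.Adj (f x) (f p)) ⊂ U :=
      Finset.filter_ssubset.2 ⟨x, hxU, G.irrefl⟩
    have h2 := Finset.card_lt_card h1
    have h3 := (Finset.card_lt_iff_ne_univ U).2 huniv
    rw [hfx] at h2 ⊢
    omega
  by_cases hall : ∀ a ∉ T.leavesAt x, a ∈ U
  · obtain ⟨w, hw⟩ : ∃ w, w ∉ U := by
      by_contra! h
      exact huniv (Finset.eq_univ_iff_forall.2 h)
    have hwx : w ∈ T.leavesAt x := by
      by_contra h
      exact hw (hall w h)
    exact key x hxU w hw hwx.1 (Or.inr fun a ha ↦ Finset.mem_insert_of_mem (hall a ha)) hcardx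
  · have hdisj := hphase.resolve_right hall
    push Not at hall
    obtain ⟨z, hzx, hzU⟩ := hall
    obtain ⟨y, hy, w, hw, hyw⟩ := hT.connected.preconnected.exists_adj_notMem
      (U := (U : Set W) ∪ T.leavesAt x) (Or.inl (by simpa using hxU) : x ∈ _) (z := z)
      (by simp [hzx, hzU])
    simp only [Set.mem_union, Finset.mem_coe, not_or] at hy hw
    have hyU : y ∈ U := by
      rcases hy with hy | hy
      · exact hy
      · exact absurd (hy.2 w hyw ▸ hxU) hw.1
    refine key y hyU w hw.1 hyw (Or.inl fun a ha h ↦ ?_) ?_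
    · rcases Finset.mem_insert.1 h with rfl | h
      · exact hw.2 ha
      · exact hdisj a ha h
    · have h1 := hf.two_mul_card_neighbors_add_two_le hG hT hconn hxU hyU hw.1 hyw hw.2 hdisj
        (hx y)
      have h2 := hmin _ (hfS y hyU)
      omega

lemma sum_card_filter_adj_erase [DecidableEq V] [DecidableRel G.Adj] {S : Finset V} {u : V}
    (hu : u ∈ S) :
    ∑ v ∈ S.erase u, ((S.erase u).filter (G.Adj v)).card + 2 * (S.filter (G.Adj u)).card =
      ∑ v ∈ S, (S.filter (G.Adj v)).card := by
  have h1 : ∀ v ∈ S.erase u, (S.filter (G.Adj v)).card =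
      ((S.erase u).filter (G.Adj v)).card + if G.Adj u v then 1 else 0 := by
    intro v _
    rw [Finset.filter_erase]
    by_cases h : G.Adj u v
    · rw [if_pos h, Finset.card_erase_add_one]
      exact Finset.mem_filter.2 ⟨hu, h.symm⟩
    · rw [if_neg h, Finset.erase_eq_of_notMem, add_zero]
      exact fun h' ↦ h (Finset.mem_filter.1 h').2.symm
  have h2 : ∑ v ∈ S.erase u, (if G.Adj u v then 1 else 0) = (S.filter (G.Adj u)).card := by
    rw [← Finset.card_filter, Finset.filter_erase, Finset.erase_eq_of_notMem]
    simp
  rw [← Finset.add_sum_erase S _ hu, Finset.sum_congr rfl h1, Finset.sum_add_distrib, h2]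
  ring

/-- A graph of average degree greater than `d` has a nonempty vertex set inducing a graph of
minimum degree greater than `d / 2` and maximum degree greater than `d`. -/
lemma exists_finset_forall_lt_card_filter_adj [Fintype V] [DecidableRel G.Adj] {d : ℕ}
    (h : d * Fintype.card V < 2 * G.edgeFinset.card) :
    ∃ S : Finset V, (∀ v ∈ S, d < 2 * (S.filter (G.Adj v)).card) ∧
      ∃ v ∈ S, d < (S.filter (G.Adj v)).card := by
  classical
  let Q : Finset V → Prop := fun S ↦ d * S.card < ∑ v ∈ S, (S.filter (G.Adj v)).card
  have hQ : Q Finset.univ := by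
    have := G.sum_degrees_eq_twice_card_edges
    simp only [← card_neighborFinset_eq_degree, neighborFinset_eq_filter] at this
    simp only [Q, Finset.card_univ]
    rw [this]
    exact h
  obtain ⟨S, -, hS⟩ := (Set.toFinite {S | Q S}).exists_le_minimal hQ
  have hSQ : d * S.card < ∑ v ∈ S, (S.filter (G.Adj v)).card := hS.prop
  refine ⟨S, fun v hv ↦ ?_, ?_⟩
  · by_contra! hle
    have hQ' : Q (S.erase v) := by
      have h1 := sum_card_filter_adj_erase (G := G) hv
      have h2 := Finset.card_erase_add_one hv
      simp only [Q]
      rw [← h2, mul_add] at hSQ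
      omega
    exact Finset.notMem_erase v S (hS.le_of_le hQ' (Finset.erase_subset _ _) hv)
  · by_contra! hle
    have := Finset.sum_le_card_nsmul S _ d hle
    rw [smul_eq_mul, mul_comm] at this
    omega

end SimpleGraph

/-- Brandt–Dobson: the Erdős–Sós conjecture holds for graphs of girth at least 5. -/
theorem erdos_sos_girth_five {V : Type*} [Fintype V] (G : SimpleGraph V) [DecidableRel G.Adj]
    (k : ℕ) (hk : 2 ≤ k)
    (hgirth : 5 ≤ G.egirth)
    (havg : (k : ℝ) - 2 < 2 * G.edgeFinset.card / Fintype.card V) :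
    ∀ (W : Type) [Fintype W] (T : SimpleGraph W), T.IsTree → Fintype.card W = k →
      ∃ f : T →g G, Function.Injective f := by
  intro W _ T hT hW
  obtain ⟨d, rfl⟩ : ∃ d, k = d + 2 := ⟨k - 2, by omega⟩
  have hd : d * Fintype.card V < 2 * G.edgeFinset.card := by
    rcases Nat.eq_zero_or_pos (Fintype.card V) with h0 | hpos
    · rw [h0] at havg
      push_cast at havg
      rw [div_zero] at havg
      have : (0 : ℝ) ≤ d := d.cast_nonneg
      linarith
    · rw [lt_div_iff₀ (by exact_mod_cast hpos)] at havg
      push_cast at havg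
      rw [add_sub_cancel_right] at havg
      exact_mod_cast havg
  classical
  obtain ⟨S, hmin, v, hv, hmax⟩ := exists_finset_forall_lt_card_filter_adj hd
  refine hT.exists_injective_hom_of_five_le_egirth hgirth (S := S) (fun u hu ↦ ?_) hv ?_
  · have := hmin u hu
    convert (by omega : d + 2 ≤ 2 * (S.filter (G.Adj u)).card + 1)
  · convert (by omega : d + 2 ≤ (S.filter (G.Adj v)).card + 1)
end

section
/- Let k ≥ 2 and let s be a positive integer with s < k/12 + 1. Let G be a finite simple graph of order n whose average degree 2·e(G)/n is strictly greater than k−2, and suppose G contains no copy of the complete bipartite graph K_{2,s} as a subgraph. Then G contains every tree of order k as a subgraph. -/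
open SimpleGraph

open Finset in
/-- Bonferroni bound for the size of a union of neighbourhoods when codegrees are bounded. -/
lemma card_mul_le_card_biUnion_neighborFinset {α : Type*} [Fintype α] [DecidableEq α]
    (H : SimpleGraph α) [DecidableRel H.Adj] {m l : ℕ} (hdeg : ∀ x, m ≤ 2 * H.degree x)
    (hco : ∀ a b, a ≠ b → #(H.neighborFinset a ∩ H.neighborFinset b) ≤ l) (X : Finset α) :
    #X * m ≤ 2 * #(X.biUnion fun x => H.neighborFinset x) + l * (#X * (#X - 1)) := by
  induction X using Finset.induction_on with
  | empty => simp
  | insert x X hx ih =>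
    have h1 : #(H.neighborFinset x ∩ X.biUnion fun x => H.neighborFinset x) ≤ #X * l := by
      rw [inter_biUnion]
      exact card_biUnion_le_card_mul _ _ _ fun y hy => hco _ _ (by rintro rfl; exact hx hy)
    have h2 := card_union_add_card_inter (H.neighborFinset x) (X.biUnion fun x => H.neighborFinset x)
    have h3 := hdeg x
    rw [card_neighborFinset_eq_degree] at h2
    rw [biUnion_insert, card_insert_of_notMem hx, Nat.add_sub_cancel]
    rcases X.eq_empty_or_nonempty with rfl | hne
    · simpa using h3
    · obtain ⟨n, hn⟩ := Nat.exists_eq_succ_of_ne_zero hne.card_pos.ne'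
      rw [hn, Nat.succ_eq_add_one] at ih h1 ⊢
      rw [Nat.add_sub_cancel] at ih
      nlinarith

open Finset in
/-- The Friedman–Pippenger argument: if the demand `D` is met by the free neighbours (those
outside `F`) of every set of at most two vertices, strictly for three or four vertices, then `w`
has a free neighbour lying in the neighbourhood of no tight set avoiding `w`. The vertex `v` is
exempt from the conditions. -/
lemma exists_free_neighbor_avoiding_tight {α : Type*} [Fintype α] [DecidableEq α]
    (N : α → Finset α) (F : Finset α) (D : α → ℕ) (v w : α)
    (hgood : ∀ X : Finset α, v ∉ X → #X ≤ 2 → ∑ x ∈ X, D x ≤ #(X.biUnion N \ F))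
    (hstrict : ∀ X : Finset α, v ∉ X → #X = 3 ∨ #X = 4 → ∑ x ∈ X, D x < #(X.biUnion N \ F))
    (hw : 0 < D w)
    (hv : w = v → ∀ X : Finset α, v ∉ X → #X ≤ 2 → ∑ x ∈ X, D x < #(N v \ F)) :
    ∃ z ∈ N w \ F, ∀ X : Finset α, v ∉ X → w ∉ X → #X ≤ 2 → z ∈ X.biUnion N →
      ∑ x ∈ X, D x < #(X.biUnion N \ F) := by
  classical
  let P : Finset α → Prop := fun X => v ∉ X ∧ w ∉ X ∧ #X ≤ 2 ∧ ∑ x ∈ X, D x = #(X.biUnion N \ F)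
  have hunion : ∀ X Y, P X → P Y → P (X ∪ Y) := by
    rintro X Y ⟨hX1, hX2, hX3, hX4⟩ ⟨hY1, hY2, hY3, hY4⟩
    have hv' : v ∉ X ∪ Y := by simp [hX1, hY1]
    have hsub : #((X ∪ Y).biUnion N \ F) + #((X ∩ Y).biUnion N \ F) ≤
        #(X.biUnion N \ F) + #(Y.biUnion N \ F) := by
      rw [← card_union_add_card_inter (X.biUnion N \ F)]
      gcongr
      · intro z hz
        simp only [mem_sdiff, mem_biUnion, mem_union] at hz ⊢
        obtain ⟨⟨a, ha | ha, hz⟩, hF⟩ := hz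
        · exact Or.inl ⟨⟨a, ha, hz⟩, hF⟩
        · exact Or.inr ⟨⟨a, ha, hz⟩, hF⟩
      · intro z hz
        simp only [mem_sdiff, mem_biUnion, mem_inter] at hz ⊢
        obtain ⟨⟨a, ⟨haX, haY⟩, hz⟩, hF⟩ := hz
        exact ⟨⟨⟨a, haX, hz⟩, hF⟩, ⟨a, haY, hz⟩, hF⟩
    have hsum := sum_union_inter (s₁ := X) (s₂ := Y) (f := D)
    have hint := hgood (X ∩ Y) (by simp [hX1]) ((card_le_card inter_subset_left).trans hX3)
    have hle : ∑ x ∈ X ∪ Y, D x ≥ #((X ∪ Y).biUnion N \ F) := by omega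
    have hc : #(X ∪ Y) ≤ 4 := (card_union_le X Y).trans (by omega)
    have hc2 : #(X ∪ Y) ≤ 2 := by
      by_contra hlt
      have := hstrict _ hv' (by omega)
      omega
    exact ⟨hv', by simp [hX2, hY2], hc2, le_antisymm (hgood _ hv' hc2) hle⟩
  have hne : ((univ : Finset (Finset α)).filter P).Nonempty :=
    ⟨∅, by simp [P]⟩
  obtain ⟨X₀, hX₀, hmax⟩ := exists_max_image _ (fun X => #X) hne
  simp only [mem_filter, mem_univ, true_and] at hX₀ hmax
  have hsub : ∀ Y, P Y → Y ⊆ X₀ := by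
    intro Y hY
    have h := eq_of_subset_of_card_le (subset_union_left (s₁ := X₀) (s₂ := Y))
      (hmax _ (hunion _ _ hX₀ hY))
    rw [h]; exact subset_union_right
  by_contra! hcon
  have hcov : N w \ F ⊆ X₀.biUnion N \ F := by
    intro z hz
    obtain ⟨X, h1, h2, h3, h4, h5⟩ := hcon z hz
    have := hsub X ⟨h1, h2, h3, le_antisymm (hgood X h1 h3) h5⟩
    exact mem_sdiff.2 ⟨biUnion_subset_biUnion_of_subset_left _ this h4, (mem_sdiff.1 hz).2⟩
  obtain ⟨hX1, hX2, hX3, hX4⟩ := hX₀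
  by_cases hwv : w = v
  · have := hv hwv X₀ hX1 hX3
    rw [hwv] at hcov
    have := card_le_card hcov
    omega
  · have hv' : v ∉ insert w X₀ := by simp [hX1, Ne.symm hwv]
    have hle : ∑ x ∈ insert w X₀, D x ≤ #((insert w X₀).biUnion N \ F) := by
      rcases Nat.lt_or_ge 2 (#(insert w X₀)) with h | h
      · refine (hstrict _ hv' (Or.inl ?_)).le
        rw [card_insert_of_notMem hX2] at h ⊢
        omega
      · exact hgood _ hv' h
    rw [sum_insert hX2, biUnion_insert, union_sdiff_distrib, union_eq_right.2 hcov] at hle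
    omega

section RootedTree
open Finset

variable {W : Type*} [Fintype W] [DecidableEq W]

/-- The number of children of `x` for the parent function `par` with root `p`. -/
def childCount (par : W → W) (p x : W) : ℕ := #{y | y ≠ p ∧ par y = x}

/-- The vertices outside `S` whose parent is in `S`. -/
def outerFrontier (par : W → W) (S : Finset W) : Finset W := {y | y ∉ S ∧ par y ∈ S}

/-- `S` contains the root and is closed under taking parents. -/
def ParentClosed (par : W → W) (p : W) (S : Finset W) : Prop :=
  p ∈ S ∧ ∀ x ∈ S, x ≠ p → par x ∈ S

lemma sum_childCount (par : W → W) (p : W) :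
    ∑ x, childCount par p x + 1 = Fintype.card W := by
  have h := card_eq_sum_card_fiberwise (f := par) (s := univ.erase p) (t := univ)
    (fun _ _ => mem_coe.2 (mem_univ _))
  rw [card_erase_of_mem (mem_univ p), card_univ] at h
  have : 0 < Fintype.card W := Fintype.card_pos_iff.2 ⟨p⟩
  have h2 : ∑ x, childCount par p x = ∑ x, #{y ∈ univ.erase p | par y = x} :=
    sum_congr rfl fun x _ => by
      unfold childCount; congr 1; ext y; simp
  omega

lemma ParentClosed.card_compl {par : W → W} {p : W} {S : Finset W} (hS : ParentClosed par p S) :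
    #Sᶜ = #(outerFrontier par S) + ∑ x ∈ Sᶜ, childCount par p x := by
  have h := card_eq_sum_card_fiberwise (f := par) (s := {y | y ∉ S ∧ par y ∉ S}) (t := Sᶜ)
    (fun y hy => by simp at hy ⊢; exact hy.2)
  have h2 : ∑ x ∈ Sᶜ, childCount par p x =
      ∑ x ∈ Sᶜ, #{y ∈ ({y | y ∉ S ∧ par y ∉ S} : Finset W) | par y = x} :=
    sum_congr rfl fun x hx => by
      unfold childCount; congr 1; ext y
      simp only [mem_compl, mem_filter, mem_univ, true_and] at hx ⊢
      have := hS.1; have := hS.2 y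
      grind
  rw [h2, ← h, outerFrontier, ← card_union_of_disjoint]
  · congr 1; ext y; simp; tauto
  · rw [Finset.disjoint_left]; intro y; simp; tauto

lemma ParentClosed.card_frontier {par : W → W} {p : W} {S : Finset W}
    (hS : ParentClosed par p S) :
    #(outerFrontier par S) + #S = 1 + ∑ x ∈ S, childCount par p x := by
  have h1 := hS.card_compl
  have h2 := sum_childCount par p
  rw [← sum_add_sum_compl S] at h2
  have h3 := card_add_card_compl S
  omega

lemma ParentClosed.childCount_le_card_frontier {par : W → W} {p : W} {S : Finset W}
    (hS : ParentClosed par p S) (hpos : ∀ s ∈ S, 1 ≤ childCount par p s) :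
    childCount par p p ≤ #(outerFrontier par S) := by
  have h1 := hS.card_frontier
  rw [← add_sum_erase _ _ hS.1] at h1
  have h2 : #(S.erase p) • 1 ≤ ∑ x ∈ S.erase p, childCount par p x :=
    card_nsmul_le_sum _ _ _ fun x hx => hpos x (mem_of_mem_erase hx)
  rw [card_erase_of_mem hS.1, smul_eq_mul] at h2
  omega

lemma ParentClosed.childCount_add_le_card_frontier {par : W → W} {p : W} {S : Finset W}
    (hS : ParentClosed par p S) (hpos : ∀ s ∈ S, 1 ≤ childCount par p s) {s : W} (hs : s ∈ S)
    (hsp : s ≠ p) :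
    childCount par p p + childCount par p s ≤ #(outerFrontier par S) + 1 := by
  have h1 := hS.card_frontier
  have hs' : s ∈ S.erase p := mem_erase.2 ⟨hsp, hs⟩
  rw [← add_sum_erase _ _ hS.1, ← add_sum_erase _ _ hs'] at h1
  have h2 : #((S.erase p).erase s) • 1 ≤ ∑ x ∈ (S.erase p).erase s, childCount par p x :=
    card_nsmul_le_sum _ _ _ fun x hx => hpos x (mem_of_mem_erase (mem_of_mem_erase hx))
  rw [card_erase_of_mem hs', card_erase_of_mem hS.1, smul_eq_mul] at h2
  omega

lemma card_frontier_filter_le_childCount {par : W → W} {p : W} {S : Finset W}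
    (hp : p ∈ S) (s : W) :
    #{y ∈ outerFrontier par S | par y = s} ≤ childCount par p s := by
  refine card_le_card fun y hy => ?_
  simp only [outerFrontier, mem_filter, mem_univ, true_and] at hy ⊢
  exact ⟨by rintro rfl; exact hy.1.1 hp, hy.2⟩

variable {α : Type*} [DecidableEq α]

/-- The number of neighbours that `x` still has to supply to extend a partial embedding `f` of
the subtree `S`; vertices not yet used are charged `d`. -/
def demand (par : W → W) (f : W → α) (S : Finset W) (d : ℕ) (x : α) : ℕ :=
  #{y ∈ outerFrontier par S | f (par y) = x} + if x ∈ S.image f then 0 else d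

lemma sum_demand (par : W → W) (f : W → α) (S : Finset W) (d : ℕ) (X : Finset α) :
    ∑ x ∈ X, demand par f S d x =
      #{y ∈ outerFrontier par S | f (par y) ∈ X} + #(X \ S.image f) * d := by
  unfold demand
  rw [sum_add_distrib]
  congr 1
  · rw [card_eq_sum_card_fiberwise (f := fun y => f (par y)) (t := X)
      (fun y hy => by simp at hy; exact hy.2)]
    refine sum_congr rfl fun x hx => ?_
    congr 1; ext y; simp only [mem_filter]; grind
  · rw [sum_ite, sum_const_zero, zero_add, sum_const, smul_eq_mul]
    congr 2
    ext; simp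

lemma demand_update_add_le {par : W → W} {p y : W} {S : Finset W} {f : W → α} {d d' : ℕ} {z : α}
    (hp : p ∈ S) (hy : y ∉ S) (hpy : par y ∈ S) (hz : z ∉ S.image f)
    (hd : d' ≤ d) (hyd : childCount par p y ≤ d) (x : α) :
    demand par (Function.update f y z) (insert y S) d' x + (if x = f (par y) then 1 else 0) ≤
      demand par f S d x := by
  have hf : ∀ t ∈ S, Function.update f y z t = f t := fun t ht =>
    Function.update_of_ne (by rintro rfl; exact hy ht) _ _
  have himg : (insert y S).image (Function.update f y z) = insert z (S.image f) := by
    rw [image_insert, Function.update_self, image_congr (g := f) fun t ht => hf t ht]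
  unfold demand
  rw [himg]
  by_cases hxz : x = z
  · subst hxz
    have h1 : x ≠ f (par y) := fun h => hz (h ▸ mem_image_of_mem f hpy)
    have h2 : #{t ∈ outerFrontier par (insert y S) | Function.update f y x (par t) = x} ≤
        childCount par p y := by
      refine card_le_card fun t ht => ?_
      simp only [outerFrontier, mem_filter, mem_univ, true_and, mem_insert, not_or] at ht ⊢
      obtain ⟨⟨⟨h3, h4⟩, h5⟩, h6⟩ := ht
      refine ⟨by rintro rfl; exact h4 hp, h5.resolve_right fun h5 => hz ?_⟩
      rw [hf _ h5] at h6
      exact h6 ▸ mem_image_of_mem f h5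
    rw [if_neg h1, if_neg hz, if_pos (mem_insert_self _ _)]
    omega
  · have hsub : ({t ∈ outerFrontier par (insert y S) | Function.update f y z (par t) = x} :
        Finset W) ⊆ ({t ∈ outerFrontier par S | f (par t) = x} : Finset W).erase y := by
      intro t ht
      simp only [outerFrontier, mem_filter, mem_univ, true_and, mem_insert, not_or,
        mem_erase] at ht ⊢
      obtain ⟨⟨⟨h3, h4⟩, h5⟩, h6⟩ := ht
      rcases h5 with h5 | h5
      · rw [h5, Function.update_self] at h6
        exact absurd h6.symm hxz
      · rw [hf _ h5] at h6
        exact ⟨h3, ⟨h4, h5⟩, h6⟩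
    have h2 := card_le_card hsub
    have h3 : (if x ∈ insert z (S.image f) then 0 else d') ≤ if x ∈ S.image f then 0 else d := by
      by_cases h : x ∈ S.image f <;> simp [h, hxz, hd]
    rw [add_right_comm]
    refine add_le_add ?_ h3
    by_cases hxy : x = f (par y)
    · have hmem : y ∈ ({t ∈ outerFrontier par S | f (par t) = x} : Finset W) := by
        simp [outerFrontier, hy, hpy, hxy]
      rw [if_pos hxy, ← card_erase_add_one hmem]
      exact Nat.add_le_add_right h2 1
    · rw [if_neg hxy, add_zero]
      exact h2.trans card_erase_le

/-- Every set of at most two vertices avoiding `v` has enough free neighbours for its demand. -/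
def MeetsDemand (N : α → Finset α) (v : α) (par : W → W) (f : W → α) (S : Finset W) (d : ℕ) :
    Prop :=
  ∀ X : Finset α, v ∉ X → #X ≤ 2 → ∑ x ∈ X, demand par f S d x ≤ #(X.biUnion N \ S.image f)

lemma MeetsDemand.update {N : α → Finset α} {v : α} {par : W → W} {p y : W} {S : Finset W}
    {f : W → α} {d d' : ℕ} {z : α} (h : MeetsDemand N v par f S d)
    (hp : p ∈ S) (hy : y ∉ S) (hpy : par y ∈ S) (hz : z ∉ S.image f)
    (hd : d' ≤ d) (hyd : childCount par p y ≤ d)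
    (hfree : ∀ X : Finset α, v ∉ X → f (par y) ∉ X → #X ≤ 2 → z ∈ X.biUnion N →
      ∑ x ∈ X, demand par f S d x < #(X.biUnion N \ S.image f)) :
    MeetsDemand N v par (Function.update f y z) (insert y S) d' := by
  intro X hvX hX
  have hf : ∀ t ∈ S, Function.update f y z t = f t := fun t ht =>
    Function.update_of_ne (by rintro rfl; exact hy ht) _ _
  have himg : (insert y S).image (Function.update f y z) = insert z (S.image f) := by
    rw [image_insert, Function.update_self, image_congr (g := f) fun t ht => hf t ht]
  have hdem := sum_le_sum fun x (_ : x ∈ X) =>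
    demand_update_add_le hp hy hpy hz hd hyd x
  rw [sum_add_distrib, sum_ite_eq' X (f (par y))] at hdem
  rw [himg, sdiff_insert]
  have hgood := h X hvX hX
  by_cases hzX : z ∈ X.biUnion N
  · rw [card_erase_of_mem (mem_sdiff.2 ⟨hzX, hz⟩)]
    by_cases hwX : f (par y) ∈ X
    · rw [if_pos hwX] at hdem
      omega
    · have := hfree X hvX hwX hX hzX
      omega
  · rw [erase_eq_of_notMem (by simp [hzX])]
    exact (Nat.le_of_add_right_le hdem).trans hgood

lemma card_frontier_filter_eq_zero {par : W → W} {S : Finset W} {f : W → α} {X : Finset α}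
    (h : #(X \ S.image f) = #X) : #{y ∈ outerFrontier par S | f (par y) ∈ X} = 0 := by
  have hX := eq_of_subset_of_card_le (sdiff_subset (s := X) (t := S.image f)) h.ge
  rw [card_eq_zero, filter_eq_empty_iff]
  intro y hy hyX
  rw [← hX] at hyX
  exact (mem_sdiff.1 hyX).2 (mem_image_of_mem f (mem_filter.1 hy).2.2)

lemma ParentClosed.exists_card_frontier_filter_le {par : W → W} {p : W} {S : Finset W} {f : W → α}
    {X : Finset α} (hS : ParentClosed par p S) (hf : Set.InjOn f S) (hX : f p ∉ X)
    (h : #(X \ S.image f) + 1 = #X) :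
    ∃ s ∈ S, s ≠ p ∧ f s ∈ X ∧
      #{y ∈ outerFrontier par S | f (par y) ∈ X} ≤ childCount par p s := by
  have h1 : #(X ∩ S.image f) = 1 := by
    have := card_sdiff_add_card_inter X (S.image f)
    omega
  obtain ⟨x, hx⟩ := card_eq_one.1 h1
  have hx' : x ∈ X ∩ S.image f := hx ▸ mem_singleton_self x
  obtain ⟨hxX, hxS⟩ := mem_inter.1 hx'
  obtain ⟨s, hs, rfl⟩ := mem_image.1 hxS
  refine ⟨s, hs, by rintro rfl; exact hX hxX, hxX,
    (card_le_card fun y hy => ?_).trans (card_frontier_filter_le_childCount hS.1 s)⟩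
  obtain ⟨hy1, hy2⟩ := mem_filter.1 hy
  refine mem_filter.2 ⟨hy1, hf (mem_filter.1 hy1).2.2 hs ?_⟩
  have : f (par y) ∈ X ∩ S.image f :=
    mem_inter.2 ⟨hy2, mem_image_of_mem f (mem_filter.1 hy1).2.2⟩
  rw [hx] at this
  exact mem_singleton.1 this

variable [Fintype α]

lemma sum_demand_lt_of_card_three_or_four (H : SimpleGraph α) [DecidableRel H.Adj] {m l d : ℕ}
    (hdeg : ∀ x, m ≤ 2 * H.degree x)
    (hco : ∀ a b, a ≠ b → #(H.neighborFinset a ∩ H.neighborFinset b) ≤ l)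
    (hl : 1 ≤ l) (hlm : 12 * l ≤ m) {par : W → W} {p : W} {S : Finset W} {f : W → α}
    (hS : ParentClosed par p S) (hf : Set.InjOn f S)
    (hcard : d + #(outerFrontier par S) + #S ≤ m + 1)
    (hpos : 1 ≤ d → ∀ s ∈ S, 1 ≤ childCount par p s)
    (hroot : 1 ≤ d → d + 1 ≤ childCount par p p)
    (hd : 4 * d < m ∨ (1 ≤ d → 2 * d ≤ #(outerFrontier par S)))
    {X : Finset α} (hX : f p ∉ X) (hX' : #X = 3 ∨ #X = 4) :
    ∑ x ∈ X, demand par f S d x < #((X.biUnion fun x => H.neighborFinset x) \ S.image f) := by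
  have h1 := card_mul_le_card_biUnion_neighborFinset H hdeg hco X
  have h2 := le_card_sdiff (S.image f) (X.biUnion fun x => H.neighborFinset x)
  have h3 : #(S.image f) = #S := card_image_of_injOn hf
  have h4 := card_filter_le (outerFrontier par S) (fun y => f (par y) ∈ X)
  have h5 := card_frontier_filter_eq_zero (par := par) (S := S) (f := f) (X := X)
  have h6 : #(X \ S.image f) + 1 = #X → 1 ≤ d →
      #{y ∈ outerFrontier par S | f (par y) ∈ X} + d ≤ #(outerFrontier par S) := by
    intro h hd
    obtain ⟨s, hs, hsp, -, hle⟩ := hS.exists_card_frontier_filter_le hf hX h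
    have := hS.childCount_add_le_card_frontier (hpos hd) hs hsp
    have := hroot hd
    omega
  have h7 : 1 ≤ d → d + 1 ≤ #(outerFrontier par S) := fun hd =>
    (hroot hd).trans (hS.childCount_le_card_frontier (hpos hd))
  have h8 := card_le_card (sdiff_subset (s := X) (t := S.image f))
  rw [sum_demand]
  generalize #(X \ S.image f) = j at *
  generalize #{y ∈ outerFrontier par S | f (par y) ∈ X} = a at *
  rcases Nat.eq_zero_or_pos d with rfl | hd0
  · rcases hX' with hX' | hX' <;> rw [hX'] at h1 <;> omega
  · rcases hX' with hX' | hX' <;> rw [hX'] at h1 h5 h6 h8 <;> interval_cases j <;> omega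

lemma sum_demand_lt_card_neighborFinset_sdiff (H : SimpleGraph α) [DecidableRel H.Adj] {m d : ℕ}
    {par : W → W} {p y : W} {S : Finset W} {f : W → α} (hv : m ≤ H.degree (f p))
    (hS : ParentClosed par p S)
    (hcard : d + #(outerFrontier par S) + #S ≤ m + 1)
    (hpos : 1 ≤ d → ∀ s ∈ S, 1 ≤ childCount par p s)
    (hroot : 1 ≤ d → d + 1 ≤ childCount par p p)
    (hy : y ∈ outerFrontier par S) (hyp : f (par y) = f p)
    {X : Finset α} (hX : f p ∉ X) (hX' : #X ≤ 2) :
    ∑ x ∈ X, demand par f S d x < #(H.neighborFinset (f p) \ S.image f) := by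
  have h1 : #(H.neighborFinset (f p) ∩ S.image f) + 1 ≤ #S := by
    have h2 : H.neighborFinset (f p) ∩ S.image f ⊆ (S.image f).erase (f p) := fun x hx => by
      obtain ⟨hx1, hx2⟩ := mem_inter.1 hx
      exact mem_erase.2 ⟨((mem_neighborFinset _ _ _).1 hx1).ne', hx2⟩
    have h3 := card_le_card h2
    have h4 := card_erase_add_one (mem_image_of_mem f hS.1)
    have h5 := card_image_le (s := S) (f := f)
    omega
  have h2 := card_sdiff_add_card_inter (H.neighborFinset (f p)) (S.image f)
  rw [card_neighborFinset_eq_degree] at h2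
  have h4 : #{y ∈ outerFrontier par S | f (par y) ∈ X} + 1 ≤ #(outerFrontier par S) := by
    refine card_lt_card (filter_ssubset.2 ⟨y, hy, ?_⟩)
    rwa [hyp]
  have h5 := card_frontier_filter_eq_zero (par := par) (S := S) (f := f) (X := X)
  have h7 : 1 ≤ d → d + 1 ≤ #(outerFrontier par S) := fun hd =>
    (hroot hd).trans (hS.childCount_le_card_frontier (hpos hd))
  have h8 := card_le_card (sdiff_subset (s := X) (t := S.image f))
  rw [sum_demand]
  generalize #(X \ S.image f) = j at *
  generalize #{y ∈ outerFrontier par S | f (par y) ∈ X} = a at *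
  have h9 : j ≤ 2 := h8.trans hX'
  rcases Nat.eq_zero_or_pos d with rfl | hd0
  · omega
  · interval_cases j <;> omega

lemma exists_embedding_of_partial (H : SimpleGraph α) [DecidableRel H.Adj] {m l : ℕ}
    (hdeg : ∀ x, m ≤ 2 * H.degree x)
    (hco : ∀ a b, a ≠ b → #(H.neighborFinset a ∩ H.neighborFinset b) ≤ l)
    (hl : 1 ≤ l) (hlm : 12 * l ≤ m) {v : α} (hv : m ≤ H.degree v)
    {par : W → W} {p : W} {depth : W → ℕ} (hdepth : ∀ x, x ≠ p → depth (par x) < depth x)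
    (hW : Fintype.card W = m + 1)
    (hmax : ∀ x, x ≠ p → childCount par p x + 1 ≤ childCount par p p)
    (S : Finset W) (f : W → α) (hS : ParentClosed par p S) (hf : Set.InjOn f S) (hfp : f p = v)
    (hadj : ∀ x ∈ S, x ≠ p → H.Adj (f (par x)) (f x))
    (hgood : MeetsDemand (fun x => H.neighborFinset x) v par f S (Sᶜ.sup (childCount par p)))
    (hA : (∀ t ∉ S, childCount par p t = 0) ∨ ∀ s ∈ S, 1 ≤ childCount par p s)
    (hB : (∀ t ∉ S, 4 * childCount par p t < m) ∨
      ∃ q ∈ S, q ≠ p ∧ ∀ t ∉ S, childCount par p t ≤ childCount par p q) :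
    ∃ g : W → α, Function.Injective g ∧ ∀ x, x ≠ p → H.Adj (g (par x)) (g x) := by
  induction hn : #Sᶜ generalizing S f with
  | zero =>
    rw [card_eq_zero, compl_eq_empty_iff] at hn
    subst hn
    exact ⟨f, Set.injOn_univ.1 (by simpa using hf), fun x => hadj x (mem_univ x)⟩
  | succ n ih =>
    set d := Sᶜ.sup (childCount par p) with hd
    have hne : Sᶜ.Nonempty := card_pos.1 (by omega)
    obtain ⟨t, ht, hdt⟩ := exists_mem_eq_sup _ hne (childCount par p)
    rw [← hd] at hdt
    have hled : ∀ x ∉ S, childCount par p x ≤ d := fun x hx => le_sup (mem_compl.2 hx)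
    have hpos : 1 ≤ d → ∀ s ∈ S, 1 ≤ childCount par p s := fun h =>
      hA.resolve_left fun h0 => by have := h0 t (mem_compl.1 ht); omega
    have hroot : 1 ≤ d → d + 1 ≤ childCount par p p := fun _ =>
      hdt ▸ hmax t (by rintro rfl; exact mem_compl.1 ht hS.1)
    have hcard : d + #(outerFrontier par S) + #S ≤ m + 1 := by
      have h1 := hS.card_compl
      have h2 := single_le_sum (f := childCount par p) (fun _ _ => Nat.zero_le _) ht
      have h3 := card_add_card_compl S
      omega
    have hd4 : 4 * d < m ∨ (1 ≤ d → 2 * d ≤ #(outerFrontier par S)) := by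
      rcases hB with hB | ⟨q, hq, hqp, hqt⟩
      · exact Or.inl (hdt ▸ hB t (mem_compl.1 ht))
      · refine Or.inr fun h => ?_
        have h1 := hS.childCount_add_le_card_frontier (hpos h) hq hqp
        have h2 := hroot h
        have h3 := hqt t (mem_compl.1 ht)
        omega
    obtain ⟨y, hy, hymin⟩ := exists_min_image ({x | x ∉ S ∧ (1 ≤ d → 1 ≤ childCount par p x)} :
      Finset W) depth ⟨t, by simp [mem_compl.1 ht]; omega⟩
    simp only [mem_filter, mem_univ, true_and, and_imp] at hy hymin
    obtain ⟨hyS, hyc⟩ := hy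
    have hyp : y ≠ p := by rintro rfl; exact hyS hS.1
    have hpy : par y ∈ S := by
      by_contra hpy
      refine absurd (hdepth y hyp) (not_lt.2 (hymin _ hpy fun _ => ?_))
      exact card_pos.2 ⟨y, by simp [hyp]⟩
    have hyfr : y ∈ outerFrontier par S := by simp [outerFrontier, hyS, hpy]
    subst hfp
    obtain ⟨z, hz, hfree⟩ := exists_free_neighbor_avoiding_tight (fun x => H.neighborFinset x)
      (S.image f) (demand par f S d) (f p) (f (par y)) hgood
      (fun X hX hX' => sum_demand_lt_of_card_three_or_four H hdeg hco hl hlm hS hf hcard hpos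
        hroot hd4 hX hX')
      (by
        have : 0 < #{t ∈ outerFrontier par S | f (par t) = f (par y)} :=
          card_pos.2 ⟨y, by simp [hyfr]⟩
        unfold demand
        omega)
      (fun hw X hX hX' => sum_demand_lt_card_neighborFinset_sdiff H hv hS hcard hpos hroot hyfr hw
        hX hX')
    obtain ⟨hzN, hzS⟩ := mem_sdiff.1 hz
    have hf' : ∀ t ∈ S, Function.update f y z t = f t := fun t ht =>
      Function.update_of_ne (by rintro rfl; exact hyS ht) _ _
    have hsub : (insert y S)ᶜ ⊆ Sᶜ := compl_subset_compl.2 (subset_insert y S)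
    refine ih (insert y S) (Function.update f y z) ⟨mem_insert_of_mem hS.1, ?_⟩ ?_ (hf' p hS.1)
      ?_ ?_ ?_ ?_ ?_
    · intro x hx hxp
      rcases mem_insert.1 hx with rfl | hx
      · exact mem_insert_of_mem hpy
      · exact mem_insert_of_mem (hS.2 x hx hxp)
    · rw [coe_insert, Set.injOn_insert (by simpa using hyS)]
      refine ⟨hf.congr fun t ht => (hf' t ht).symm, ?_⟩
      rw [Function.update_self, Set.image_congr fun t ht => hf' t ht]
      simpa using hzS
    · intro x hx hxp
      rcases mem_insert.1 hx with rfl | hx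
      · rw [Function.update_self, hf' _ hpy]
        exact (mem_neighborFinset _ _ _).1 hzN
      · rw [hf' _ hx, hf' _ (hS.2 x hx hxp)]
        exact hadj x hx hxp
    · exact hgood.update hS.1 hyS hpy hzS (sup_mono hsub) (hled y hyS) hfree
    · rcases Nat.eq_zero_or_pos d with h0 | h0
      · exact Or.inl fun x hx => Nat.eq_zero_of_le_zero
          (h0 ▸ hled x fun h => hx (mem_insert_of_mem h))
      · refine Or.inr fun x hx => ?_
        rcases mem_insert.1 hx with rfl | hx
        · exact hyc h0
        · exact hpos h0 x hx
    · rcases hB with hB | ⟨q, hq, hqp, hqt⟩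
      · exact Or.inl fun x hx => hB x fun h => hx (mem_insert_of_mem h)
      · exact Or.inr ⟨q, mem_insert_of_mem hq, hqp, fun x hx =>
          hqt x fun h => hx (mem_insert_of_mem h)⟩
    · rw [compl_insert, card_erase_of_mem (mem_compl.2 hyS), hn, Nat.add_sub_cancel]

end RootedTree

section Path
open Finset

variable {α : Type*} [Fintype α] [DecidableEq α]

lemma exists_path_with_few_backward_neighbors (H : SimpleGraph α) [DecidableRel H.Adj]
    {m l c g : ℕ} (hdeg : ∀ x, m ≤ 2 * H.degree x)
    (hco : ∀ a b, a ≠ b → #(H.neighborFinset a ∩ H.neighborFinset b) ≤ l)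
    (hl : 1 ≤ l) (hlm : 12 * l ≤ m) {v : α} (hv : m ≤ H.degree v)
    (hc : m ≤ 4 * c) (hgc : g + c = (m + 1) / 2) (hg : 1 ≤ g) (j : ℕ) (hj : 1 ≤ j)
    (hjg : j ≤ 2 * g) :
    ∃ w : ℕ → α, w 0 = v ∧ (∀ i < j, H.Adj (w i) (w (i + 1))) ∧ Set.InjOn w (range (j + 1)) ∧
      #(H.neighborFinset (w j) ∩ (range j).image w) ≤ g ∧
      (l < j → ∀ a, ∃ i ≤ j, ¬ H.Adj a (w i)) := by
  induction j, hj using Nat.le_induction with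
  | base =>
    obtain ⟨z, hz⟩ : (H.neighborFinset v).Nonempty := by
      rw [← card_pos, card_neighborFinset_eq_degree]; omega
    rw [mem_neighborFinset] at hz
    refine ⟨fun i => if i = 0 then v else z, rfl, ?_, ?_, ?_, by omega⟩
    · intro i hi
      obtain rfl : i = 0 := by omega
      exact hz
    · have := hz.ne
      intro a ha b hb hab
      simp only [coe_range, Set.mem_Iio] at ha hb
      interval_cases a <;> interval_cases b <;> simp_all
    · refine (card_le_card inter_subset_right).trans (card_image_le.trans ?_)
      simpa using hg
  | succ j hj ih =>
    obtain ⟨w, hw0, hadj, hinj, hback, hcov⟩ := ih (by omega)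
    set P := (range (j + 1)).image w with hP
    set O := H.neighborFinset (w j) \ P with hO
    have hPcard : #P = j + 1 := by rw [hP, card_image_of_injOn hinj, card_range]
    have hjP : w j ∈ P := mem_image_of_mem w (by simp)
    have hOcard : c ≤ #O := by
      have h1 : H.neighborFinset (w j) ∩ P ⊆ H.neighborFinset (w j) ∩ (range j).image w := by
        intro z hz
        obtain ⟨hz1, hz2⟩ := mem_inter.1 hz
        rw [hP, range_add_one, image_insert, mem_insert] at hz2
        rw [mem_neighborFinset] at hz1
        exact mem_inter.2 ⟨(mem_neighborFinset _ _ _).2 hz1, hz2.resolve_left hz1.ne'⟩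
      have h2 := card_le_card h1
      have h3 := card_sdiff_add_card_inter (H.neighborFinset (w j)) P
      rw [card_neighborFinset_eq_degree] at h3
      have := hdeg (w j)
      rw [hO]
      omega
    set B := {z ∈ O | g < #(H.neighborFinset z ∩ P)}
    have hBcard : #B < 2 * l := by
      have h1 : #B • g ≤ ∑ z ∈ B, #(bipartiteAbove H.Adj (P.erase (w j)) z) := by
        refine card_nsmul_le_sum _ _ _ fun z hz => ?_
        have h2 := (mem_filter.1 hz).2
        have h3 : bipartiteAbove H.Adj (P.erase (w j)) z =
            (H.neighborFinset z ∩ P).erase (w j) := by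
          ext a; simp [bipartiteAbove]; tauto
        have := pred_card_le_card_erase (s := H.neighborFinset z ∩ P) (a := w j)
        rw [h3]
        omega
      rw [sum_card_bipartiteAbove_eq_sum_card_bipartiteBelow (r := H.Adj)] at h1
      have h2 : ∑ a ∈ P.erase (w j), #(bipartiteBelow H.Adj B a) ≤ #(P.erase (w j)) • l := by
        refine sum_le_card_nsmul _ _ _ fun a ha => ?_
        refine (card_le_card fun z hz => ?_).trans (hco a (w j) (ne_of_mem_erase ha))
        obtain ⟨hz1, hz2⟩ := mem_filter.1 hz
        have hz3 := (mem_sdiff.1 (mem_filter.1 hz1).1).1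
        exact mem_inter.2 ⟨(mem_neighborFinset _ _ _).2 hz2.symm, hz3⟩
      have h3 := h1.trans h2
      rw [card_erase_of_mem hjP, hPcard, Nat.add_sub_cancel, smul_eq_mul, smul_eq_mul] at h3
      by_contra! h4
      nlinarith
    set A := {z ∈ O | l < j + 1 ∧ ∃ a, (∀ i ≤ j, H.Adj a (w i)) ∧ H.Adj a z}
    have hAcard : #A ≤ l := by
      rcases A.eq_empty_or_nonempty with hAe | ⟨z, hz⟩
      · simp [hAe]
      obtain ⟨-, hlj, a, ha, -⟩ := mem_filter.1 hz
      refine (card_le_card fun y hy => ?_).trans (hco a (w j) (ha j le_rfl).ne)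
      obtain ⟨hyO, -, b, hb, hby⟩ := mem_filter.1 hy
      obtain rfl : b = a := by
        by_contra hba
        have h1 : P ⊆ H.neighborFinset b ∩ H.neighborFinset a := by
          intro x hx
          obtain ⟨i, hi, rfl⟩ := mem_image.1 hx
          have hi := Nat.lt_succ_iff.1 (mem_range.1 hi)
          simp [ha i hi, hb i hi]
        have := (card_le_card h1).trans (hco b a hba)
        omega
      exact mem_inter.2 ⟨(mem_neighborFinset _ _ _).2 hby, (mem_sdiff.1 hyO).1⟩
    obtain ⟨z, hz⟩ : (O \ (A ∪ B)).Nonempty := by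
      rw [← card_pos]
      have h1 := le_card_sdiff (A ∪ B) O
      have h2 := card_union_le A B
      omega
    obtain ⟨hzO, hzAB⟩ := mem_sdiff.1 hz
    rw [mem_union, not_or] at hzAB
    obtain ⟨hzN, hzP⟩ := mem_sdiff.1 hzO
    have hw' : ∀ i ≤ j, Function.update w (j + 1) z i = w i := fun i hi =>
      Function.update_of_ne (by omega) _ _
    have himg : (range (j + 1)).image (Function.update w (j + 1) z) = P :=
      image_congr fun i hi => hw' i (by simp at hi; omega)
    refine ⟨Function.update w (j + 1) z, by rw [hw' 0 (Nat.zero_le _), hw0], ?_, ?_, ?_, ?_⟩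
    · intro i hi
      rcases Nat.lt_succ_iff_lt_or_eq.1 hi with hi | rfl
      · rw [hw' i hi.le, hw' (i + 1) hi]
        exact hadj i hi
      · rw [hw' i le_rfl, Function.update_self]
        exact (mem_neighborFinset _ _ _).1 hzN
    · rw [range_add_one, coe_insert, Set.injOn_insert (by simp)]
      refine ⟨hinj.congr fun i hi => (hw' i (by simp at hi; omega)).symm, ?_⟩
      rw [Function.update_self, ← coe_image, himg]
      exact hzP
    · rw [Function.update_self, himg]
      by_contra! h
      exact hzAB.2 (mem_filter.2 ⟨hzO, h⟩)
    · intro hlj a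
      by_contra! h
      refine hzAB.1 (mem_filter.2 ⟨hzO, hlj, a, fun i hi => ?_, ?_⟩)
      · rw [← hw' i hi]; exact h i (by omega)
      · simpa using h (j + 1) le_rfl

end Path

section RootedTree
open Finset

variable {W : Type*} [Fintype W] [DecidableEq W] {α : Type*} [Fintype α] [DecidableEq α]

lemma meetsDemand_singleton (H : SimpleGraph α) [DecidableRel H.Adj] {m l d : ℕ}
    (hdeg : ∀ x, m ≤ 2 * H.degree x)
    (hco : ∀ a b, a ≠ b → #(H.neighborFinset a ∩ H.neighborFinset b) ≤ l)
    (hl : 1 ≤ l) (hlm : 12 * l ≤ m) (v : α) (par : W → W) (p : W) (hd : 4 * d < m) :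
    MeetsDemand (fun x => H.neighborFinset x) v par (fun _ => v) {p} d := by
  intro X hvX hX
  have h1 := card_mul_le_card_biUnion_neighborFinset H hdeg hco X
  have h2 := le_card_sdiff {v} (X.biUnion fun x => H.neighborFinset x)
  rw [sum_demand]
  simp only [hvX, filter_false, card_empty, zero_add, image_singleton]
  rw [sdiff_singleton_eq_erase, erase_eq_of_notMem hvX]
  rw [card_singleton] at h2
  interval_cases #X <;> omega

lemma card_filter_add_card_filter_le {β : Type*} {s : Finset β} {P Q : β → Prop}
    [DecidablePred P] [DecidablePred Q] (h : ∀ x ∈ s, P x → ¬ Q x) :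
    #(s.filter P) + #(s.filter Q) ≤ #s := by
  classical
  rw [← card_union_of_disjoint (disjoint_filter.2 h)]
  exact card_le_card (union_subset (filter_subset _ _) (filter_subset _ _))

lemma meetsDemand_path (H : SimpleGraph α) [DecidableRel H.Adj] {m l c g d j : ℕ}
    (hdeg : ∀ x, m ≤ 2 * H.degree x)
    (hco : ∀ a b, a ≠ b → #(H.neighborFinset a ∩ H.neighborFinset b) ≤ l)
    (hlm : 12 * l ≤ m) (hc : m ≤ 4 * c) (hgc : g + c = (m + 1) / 2)
    {w : ℕ → α} (hinj : Set.InjOn w (range (j + 1)))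
    (hback : #(H.neighborFinset (w j) ∩ (range j).image w) ≤ g)
    (hcov : l < j → ∀ a, ∃ i ≤ j, ¬ H.Adj a (w i))
    {par : W → W} {p q : W} {S : Finset W} {f : W → α} (hS : ParentClosed par p S) (hq : q ∈ S)
    (hqp : q ≠ p) (hf : Set.InjOn f S) (hF : S.image f = (range (j + 1)).image w)
    (hfp : f p = w 0) (hfq : f q = w j)
    (hfrp : c ≤ #{y ∈ outerFrontier par S | par y = p})
    (hfrq : c ≤ #{y ∈ outerFrontier par S | par y = q}) (hcq : childCount par p q ≤ c)
    (hcard : d + #(outerFrontier par S) + j ≤ m) (hdc : d ≤ c) :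
    MeetsDemand (fun x => H.neighborFinset x) (w 0) par f S d := by
  intro X hvX hX
  have hpq : ∀ y ∈ outerFrontier par S, par y = p → ¬ par y = q := fun y _ h1 h2 =>
    hqp (h2 ▸ h1)
  have hfr2 := card_filter_add_card_filter_le hpq
  have ha1 : #{y ∈ outerFrontier par S | f (par y) ∈ X} + c ≤ #(outerFrontier par S) := by
    refine (Nat.add_le_add_left hfrp _).trans (card_filter_add_card_filter_le fun y _ h1 h2 => ?_)
    rw [h2, hfp] at h1
    exact hvX h1
  have ha2 : w j ∉ X →
      #{y ∈ outerFrontier par S | f (par y) ∈ X} + (c + c) ≤ #(outerFrontier par S) := by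
    intro hjX
    refine (Nat.add_le_add_left (Nat.add_le_add hfrp hfrq) _).trans ?_
    rw [← card_union_of_disjoint (disjoint_filter.2 hpq), ← filter_or]
    refine card_filter_add_card_filter_le fun y _ h1 h2 => ?_
    rcases h2 with h2 | h2
    · rw [h2, hfp] at h1
      exact hvX h1
    · rw [h2, hfq] at h1
      exact hjX h1
  have ha3 := card_frontier_filter_eq_zero (par := par) (S := S) (f := f) (X := X)
  have h8 := card_le_card (sdiff_subset (s := X) (t := S.image f))
  have hFcard : #(S.image f) = j + 1 := by rw [hF, card_image_of_injOn hinj, card_range]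
  rw [sum_demand]
  obtain hX0 | hX1 | hX2 : #X = 0 ∨ #X = 1 ∨ #X = 2 := by omega
  · rw [card_eq_zero] at hX0
    simp [hX0]
  · obtain ⟨x, rfl⟩ := card_eq_one.1 hX1
    rw [singleton_biUnion]
    have hx := hdeg x
    have h2 := card_sdiff_add_card_inter (H.neighborFinset x) (S.image f)
    rw [card_neighborFinset_eq_degree] at h2
    by_cases hxF : x ∈ S.image f
    · have h3 : #({x} \ S.image f) = 0 := by simp [sdiff_eq_empty_iff_subset, hxF]
      rw [h3, zero_mul, add_zero]
      by_cases hxj : x = w j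
      · obtain ⟨s, hs, -, hsX, hle⟩ := hS.exists_card_frontier_filter_le hf (X := {x})
          (by rwa [hfp]) (by rw [h3, hX1])
        obtain rfl : s = q := hf hs hq (by rw [hfq, mem_singleton.1 hsX, hxj])
        have h4 : H.neighborFinset x ∩ S.image f ⊆ H.neighborFinset (w j) ∩ (range j).image w := by
          intro z hz
          obtain ⟨hz1, hz2⟩ := mem_inter.1 hz
          rw [hxj] at hz1
          rw [hF, range_add_one, image_insert, mem_insert] at hz2
          exact mem_inter.2 ⟨hz1, hz2.resolve_left ((mem_neighborFinset _ _ _).1 hz1).ne'⟩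
        have h5 := card_le_card h4
        omega
      · have h4 : H.neighborFinset x ∩ S.image f ⊆ (S.image f).erase x := fun z hz => by
          obtain ⟨hz1, hz2⟩ := mem_inter.1 hz
          exact mem_erase.2 ⟨((mem_neighborFinset _ _ _).1 hz1).ne', hz2⟩
        have h5 := card_le_card h4
        rw [card_erase_of_mem hxF] at h5
        have := ha2 (by simpa using Ne.symm hxj)
        omega
    · have h3 : #({x} \ S.image f) = 1 := by
        rw [sdiff_eq_self_of_disjoint (by simpa using hxF), card_singleton]
      rw [ha3 (by rw [h3, hX1]), h3, one_mul, zero_add]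
      have h6 := card_le_card (inter_subset_right (s₁ := H.neighborFinset x) (s₂ := S.image f))
      by_cases hall : ∃ i ≤ j, ¬ H.Adj x (w i)
      · obtain ⟨i, hi, hxi⟩ := hall
        have h4 : H.neighborFinset x ∩ S.image f ⊆ (S.image f).erase (w i) := fun z hz => by
          obtain ⟨hz1, hz2⟩ := mem_inter.1 hz
          refine mem_erase.2 ⟨?_, hz2⟩
          rintro rfl
          exact hxi ((mem_neighborFinset _ _ _).1 hz1)
        have h5 := card_le_card h4
        rw [card_erase_of_mem (hF ▸ mem_image_of_mem w (mem_range.2 (by omega)))] at h5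
        omega
      · have hlj : ¬ l < j := fun h => hall (hcov h x)
        omega
  · have h1 := card_mul_le_card_biUnion_neighborFinset H hdeg hco X
    have h2 := le_card_sdiff (S.image f) (X.biUnion fun x => H.neighborFinset x)
    rw [hX2] at h1 ha3
    generalize #(X \ S.image f) = u at *
    have hu : u ≤ 2 := h8.trans hX2.le
    interval_cases u <;> omega

lemma exists_embedding (H : SimpleGraph α) [DecidableRel H.Adj] {m l : ℕ}
    (hdeg : ∀ x, m ≤ 2 * H.degree x)
    (hco : ∀ a b, a ≠ b → #(H.neighborFinset a ∩ H.neighborFinset b) ≤ l)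
    (hl : 1 ≤ l) (hlm : 12 * l ≤ m) {v : α} (hv : m ≤ H.degree v)
    {par : W → W} {p : W} {depth : W → ℕ} (hdp : depth p = 0)
    (hdepth : ∀ x, x ≠ p → depth (par x) + 1 = depth x)
    (hW : Fintype.card W = m + 1)
    (hmax : ∀ x, x ≠ p → childCount par p x + 1 ≤ childCount par p p) :
    ∃ g : W → α, Function.Injective g ∧ ∀ x, x ≠ p → H.Adj (g (par x)) (g x) := by
  have hdepth' : ∀ x, x ≠ p → depth (par x) < depth x := fun x hx => by
    have := hdepth x hx; omega
  have hne : (univ.erase p).Nonempty := by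
    rw [← card_pos, card_erase_of_mem (mem_univ p), card_univ]; omega
  obtain ⟨q, hqp, hqmax⟩ := exists_max_image _ (childCount par p) hne
  simp only [mem_erase, mem_univ, and_true] at hqp hqmax
  rcases Nat.lt_or_ge (4 * childCount par p q) m with hqm | hqm
  · have hlt : ∀ t ∉ ({p} : Finset W), 4 * childCount par p t < m := fun t ht => by
      have := hqmax t (by simpa using ht); omega
    refine exists_embedding_of_partial H hdeg hco hl hlm hv hdepth' hW hmax {p} (fun _ => v)
      ⟨mem_singleton_self p, fun x hx hxp => absurd (mem_singleton.1 hx) hxp⟩ (by simp) rfl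
      (fun x hx hxp => absurd (mem_singleton.1 hx) hxp) ?_ ?_ (Or.inl hlt)
    · refine meetsDemand_singleton H hdeg hco hl hlm v par p ?_
      obtain ⟨t, ht, hdt⟩ := exists_mem_eq_sup ({p} : Finset W)ᶜ ⟨q, by simpa using hqp⟩ (childCount par p)
      rw [hdt]
      exact hlt t (mem_compl.1 ht)
    · refine Or.inr fun s hs => ?_
      rw [mem_singleton.1 hs]
      exact (Nat.le_add_left 1 _).trans (hmax q hqp)
  · set c := childCount par p q with hc
    set j := depth q with hj
    have hiter : ∀ i ≤ j, depth (par^[i] q) + i = j := by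
      intro i hi
      induction i with
      | zero => rfl
      | succ i ih =>
        have h1 := ih (by omega)
        have h2 := hdepth (par^[i] q) fun h => by rw [h, hdp] at h1; omega
        rw [Function.iterate_succ_apply']
        omega
    have hd0 : ∀ x, depth x = 0 → x = p := fun x hx => by
      by_contra h
      have := hdepth x h
      omega
    have hj1 : 1 ≤ j := by
      by_contra h
      exact hqp (hd0 q (by omega))
    set S := (range (j + 1)).image fun i => par^[i] q
    have hmemS : ∀ x ∈ S, par^[j - depth x] q = x ∧ depth x ≤ j := by
      intro x hx
      obtain ⟨i, hi, rfl⟩ := mem_image.1 hx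
      have hi := Nat.lt_succ_iff.1 (mem_range.1 hi)
      have := hiter i hi
      exact ⟨by congr 2; omega, by omega⟩
    have hmemS' : ∀ i ≤ j, par^[i] q ∈ S := fun i hi =>
      mem_image.2 ⟨i, mem_range.2 (by omega), rfl⟩
    have hdinj : Set.InjOn depth S := fun x hx y hy hxy => by
      rw [← (hmemS x hx).1, ← (hmemS y hy).1, hxy]
    have hpS : p ∈ S := by
      rw [← hd0 (par^[j] q) (by have := hiter j le_rfl; omega)]
      exact hmemS' j le_rfl
    have hqS : q ∈ S := hmemS' 0 (Nat.zero_le _)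
    have hS : ParentClosed par p S := by
      refine ⟨hpS, fun x hx hxp => ?_⟩
      obtain ⟨h1, h2⟩ := hmemS x hx
      have h3 := hdepth x hxp
      rw [← h1, ← Function.iterate_succ_apply' par]
      exact hmemS' _ (by omega)
    have hdimg : S.image depth = range (j + 1) := by
      ext i
      simp only [mem_image, mem_range]
      constructor
      · rintro ⟨x, hx, rfl⟩
        exact Nat.lt_succ_of_le (hmemS x hx).2
      · intro hi
        have := hiter (j - i) (by omega)
        exact ⟨_, hmemS' (j - i) (by omega), by omega⟩
    have hScard : #S = j + 1 := by
      rw [← card_image_of_injOn hdinj, hdimg, card_range]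
    have hpos : ∀ s ∈ S, 1 ≤ childCount par p s := by
      intro s hs
      obtain ⟨h1, h2⟩ := hmemS s hs
      rcases h2.eq_or_lt with h2 | h2
      · rw [h2, Nat.sub_self] at h1
        rw [← h1]
        change 1 ≤ c
        omega
      · have h3 := hiter (j - depth s - 1) (by omega)
        refine card_pos.2 ⟨par^[j - depth s - 1] q, mem_filter.2 ⟨mem_univ _, ?_, ?_⟩⟩
        · intro h
          rw [h, hdp] at h3
          omega
        · rw [← Function.iterate_succ_apply' par, ← h1]
          congr 2
          rw [h1]
          omega
    have hchild : ∀ s ∈ S, childCount par p s ≤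
        #{y ∈ outerFrontier par S | par y = s} + #{y ∈ S | y ≠ p ∧ par y = s} := by
      intro s hs
      refine (card_le_card fun y hy => ?_).trans (card_union_le _ _)
      obtain ⟨-, hyp, rfl⟩ := mem_filter.1 hy
      by_cases hyS : y ∈ S
      · exact mem_union_right _ (mem_filter.2 ⟨hyS, hyp, rfl⟩)
      · exact mem_union_left _ (mem_filter.2 ⟨mem_filter.2 ⟨mem_univ _, hyS, hs⟩, rfl⟩)
    have hfrp : childCount par p p ≤ #{y ∈ outerFrontier par S | par y = p} + 1 := by
      refine (hchild p hpS).trans (Nat.add_le_add_left ?_ _)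
      refine card_le_one.2 fun a ha b hb => ?_
      obtain ⟨ha, hap, ha'⟩ := mem_filter.1 ha
      obtain ⟨hb, hbp, hb'⟩ := mem_filter.1 hb
      refine hdinj ha hb ?_
      rw [← hdepth a hap, ← hdepth b hbp, ha', hb']
    have hfrq : c ≤ #{y ∈ outerFrontier par S | par y = q} := by
      refine (hchild q hqS).trans_eq ?_
      rw [Nat.add_eq_left, card_eq_zero, filter_eq_empty_iff]
      rintro y hy ⟨hyp, hyq⟩
      have h1 := hdepth y hyp
      have h2 := (hmemS y hy).2
      rw [hyq] at h1
      omega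
    have hcp := hmax q hqp
    rw [← hc] at hcp
    have hfr := hS.childCount_add_le_card_frontier hpos hqS hqp
    rw [← hc] at hfr
    have hcompl := hS.card_compl
    have hSc := card_add_card_compl S
    have hdc : Sᶜ.sup (childCount par p) ≤ c := Finset.sup_le fun t ht =>
      hqmax t (by rintro rfl; exact mem_compl.1 ht hpS)
    have hdsum : Sᶜ.sup (childCount par p) ≤ ∑ t ∈ Sᶜ, childCount par p t :=
      Finset.sup_le fun t ht => single_le_sum (fun _ _ => Nat.zero_le _) ht
    obtain ⟨w, hw0, hwadj, hwinj, hback, hcov⟩ := exists_path_with_few_backward_neighbors H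
      (g := (m + 1) / 2 - c) hdeg hco hl hlm hv hqm (by omega) (by omega) j hj1 (by omega)
    have hfinj : Set.InjOn (w ∘ depth) S := by
      refine hwinj.comp hdinj fun x hx => ?_
      rw [← hdimg]
      exact mem_coe.2 (mem_image_of_mem _ hx)
    refine exists_embedding_of_partial H hdeg hco hl hlm hv hdepth' hW hmax S (w ∘ depth) hS hfinj
      (by simp [hdp, hw0]) ?_ ?_ (Or.inr hpos)
      (Or.inr ⟨q, hqS, hqp, fun t ht => hqmax t (by rintro rfl; exact ht hpS)⟩)
    · intro x hx hxp
      have h1 := hdepth x hxp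
      have h2 := (hmemS x hx).2
      rw [Function.comp_apply, Function.comp_apply, ← h1]
      exact hwadj _ (by omega)
    · rw [← hw0]
      exact meetsDemand_path H (g := (m + 1) / 2 - c) (c := c) hdeg hco hlm hqm (by omega) hwinj
        hback hcov hS hqS hqp hfinj (by rw [← image_image, hdimg]) (by simp [hdp]) rfl (by omega)
        hfrq le_rfl (by omega) hdc

lemma SimpleGraph.IsTree.exists_rooted {W : Type*} [Fintype W] [DecidableEq W] {T : SimpleGraph W}
    (hT : T.IsTree) :
    ∃ (p : W) (par : W → W) (depth : W → ℕ), depth p = 0 ∧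
      (∀ x, x ≠ p → depth (par x) + 1 = depth x) ∧
      (∀ a b, T.Adj a b → (b ≠ p ∧ par b = a) ∨ (a ≠ p ∧ par a = b)) ∧
      ∀ x, x ≠ p → childCount par p x + 1 ≤ childCount par p p := by
  classical
  have := hT.connected.nonempty
  obtain ⟨p, hp⟩ := T.exists_maximal_degree_vertex
  have hex : ∀ x, x ≠ p → ∃ y, T.Adj y x ∧ T.dist p y + 1 = T.dist p x := by
    intro x hx
    obtain ⟨q, hq⟩ := hT.connected.exists_walk_length_eq_dist x p
    cases q with
    | nil => exact absurd rfl hx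
    | @cons _ y _ hxy q =>
      refine ⟨y, hxy.symm, ?_⟩
      have h1 := dist_le q
      have h2 := hxy.diff_dist_adj (u := p)
      rw [Walk.length_cons, dist_comm] at hq
      rw [dist_comm] at h1
      omega
  have hex' : ∀ x, ∃ y, x ≠ p → T.Adj y x ∧ T.dist p y + 1 = T.dist p x := fun x => by
    by_cases hx : x = p
    · exact ⟨x, fun h => absurd hx h⟩
    · exact (hex x hx).imp fun y hy _ => hy
  choose par hpar using hex'
  have hedge : ∀ a b, T.Adj a b → (b ≠ p ∧ par b = a) ∨ (a ≠ p ∧ par a = b) := by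
    have hinj : Set.InjOn (fun x => s(par x, x)) (univ.erase p : Finset W) := by
      intro x hx y hy hxy
      have hx := (hpar x (ne_of_mem_erase hx)).2
      have hy := (hpar y (ne_of_mem_erase hy)).2
      rcases Sym2.eq_iff.1 hxy with ⟨-, h⟩ | ⟨h1, h2⟩
      · exact h
      · rw [h1] at hx
        rw [← h2] at hy
        omega
    have himg : (univ.erase p).image (fun x => s(par x, x)) = T.edgeFinset := by
      refine eq_of_subset_of_card_le ?_ ?_
      · rw [image_subset_iff]
        intro x hx
        rw [mem_edgeFinset, mem_edgeSet]
        exact (hpar x (ne_of_mem_erase hx)).1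
      · rw [card_image_of_injOn hinj, card_erase_of_mem (mem_univ p), card_univ,
          ← hT.card_edgeFinset, Nat.add_sub_cancel]
    intro a b hab
    have : s(a, b) ∈ (univ.erase p).image (fun x => s(par x, x)) := by
      rw [himg, mem_edgeFinset]; exact hab
    obtain ⟨x, hx, hxab⟩ := mem_image.1 this
    rcases Sym2.eq_iff.1 hxab with ⟨rfl, rfl⟩ | ⟨rfl, rfl⟩
    · exact Or.inl ⟨ne_of_mem_erase hx, rfl⟩
    · exact Or.inr ⟨ne_of_mem_erase hx, rfl⟩
  refine ⟨p, par, T.dist p, dist_self, fun x hx => (hpar x hx).2, hedge, fun x hx => ?_⟩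
  have h1 : childCount par p x + 1 ≤ T.degree x := by
    have h2 : par x ∉ ({y | y ≠ p ∧ par y = x} : Finset W) := by
      simp only [mem_filter, mem_univ, true_and, not_and]
      intro h3 h4
      have h5 := (hpar x hx).2
      have h6 := (hpar _ h3).2
      rw [h4] at h6
      omega
    rw [← card_neighborFinset_eq_degree, childCount, ← card_insert_of_notMem h2]
    refine card_le_card fun y hy => ?_
    rw [mem_neighborFinset]
    rcases mem_insert.1 hy with rfl | hy
    · exact (hpar x hx).1.symm
    · obtain ⟨-, hyp, rfl⟩ := mem_filter.1 hy
      exact (hpar y hyp).1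
  have h2 : T.degree p ≤ childCount par p p := by
    rw [← card_neighborFinset_eq_degree]
    refine card_le_card fun y hy => ?_
    rw [mem_neighborFinset] at hy
    simpa using hedge p y hy
  have h3 := T.degree_le_maxDegree x
  omega

end RootedTree

open Finset in
lemma SimpleGraph.exists_induced_degree_bounds {V : Type*} [Fintype V] [DecidableEq V]
    (G : SimpleGraph V) [DecidableRel G.Adj] {m : ℕ}
    (h : m * Fintype.card V < 2 * #G.edgeFinset + Fintype.card V) :
    ∃ U : Finset V, (∀ x ∈ U, m ≤ 2 * #(G.neighborFinset x ∩ U)) ∧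
      ∃ v ∈ U, m ≤ #(G.neighborFinset v ∩ U) := by
  obtain ⟨U, hU, hmin⟩ := exists_min_image
    ({U | m * #U < ∑ x ∈ U, #(G.neighborFinset x ∩ U) + #U} : Finset (Finset V)) (fun U => #U)
    ⟨univ, by simpa [G.sum_degrees_eq_twice_card_edges] using h⟩
  simp only [mem_filter, mem_univ, true_and] at hU hmin
  refine ⟨U, fun x hx => ?_, ?_⟩
  · have h1 : ∑ y ∈ U, #(G.neighborFinset y ∩ U) =
        2 * #(G.neighborFinset x ∩ U) + ∑ y ∈ U.erase x, #(G.neighborFinset y ∩ U.erase x) := by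
      have h2 : ∀ y ∈ U.erase x, #(G.neighborFinset y ∩ U) =
          #(G.neighborFinset y ∩ U.erase x) + if y ∈ G.neighborFinset x then 1 else 0 := by
        intro y hy
        rw [inter_erase]
        split_ifs with hxy
        · rw [card_erase_add_one]
          rw [mem_neighborFinset] at hxy
          simp [hx, hxy.symm]
        · rw [erase_eq_of_notMem, add_zero]
          rw [mem_neighborFinset] at hxy
          simp [hx, G.adj_comm, hxy]
      rw [← add_sum_erase _ _ hx, sum_congr rfl h2, sum_add_distrib, sum_boole]
      have h3 : ({y ∈ U.erase x | y ∈ G.neighborFinset x} : Finset V) =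
          G.neighborFinset x ∩ U := by
        ext y
        simp only [mem_filter, mem_erase, mem_inter, mem_neighborFinset]
        exact ⟨fun h => ⟨h.2, h.1.2⟩, fun h => ⟨⟨h.1.ne', h.2⟩, h.1⟩⟩
      rw [h3, Nat.cast_id]
      ring
    have h4 := card_erase_add_one hx
    have h5 : ¬ m * #(U.erase x) <
        ∑ y ∈ U.erase x, #(G.neighborFinset y ∩ U.erase x) + #(U.erase x) := fun h => by
      have := hmin _ h
      omega
    rw [← h4] at hU
    rw [h1] at hU
    nlinarith
  · by_contra! hcon
    have h1 : ∑ x ∈ U, (#(G.neighborFinset x ∩ U) + 1) ≤ #U • m :=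
      sum_le_card_nsmul _ _ _ hcon
    rw [sum_add_distrib, sum_const, smul_eq_mul, smul_eq_mul, mul_one, mul_comm] at h1
    omega

open Finset in
lemma SimpleGraph.card_inter_neighborFinset_lt_of_K2s_free {V : Type*} [Fintype V] [DecidableEq V]
    (G : SimpleGraph V) [DecidableRel G.Adj] {s : ℕ}
    (h : ¬ ∃ f : completeBipartiteGraph (Fin 2) (Fin s) →g G, Function.Injective f)
    {a b : V} (hab : a ≠ b) : #(G.neighborFinset a ∩ G.neighborFinset b) < s := by
  by_contra! hs
  obtain ⟨e⟩ := Function.Embedding.nonempty_of_card_le (α := Fin s)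
    (β := ↥(G.neighborFinset a ∩ G.neighborFinset b)) (by rwa [Fintype.card_fin, Fintype.card_coe])
  have he : ∀ i, G.Adj a (e i) ∧ G.Adj b (e i) := fun i => by
    have := (e i).2
    simpa only [mem_inter, mem_neighborFinset] using this
  have hadj : ∀ i j, G.Adj (![a, b] i) (e j) := fun i j => by
    fin_cases i
    · exact (he j).1
    · exact (he j).2
  refine h ⟨⟨Sum.elim ![a, b] fun j => (e j : V), ?_⟩, ?_⟩
  · rintro (i | i) (j | j) hij
    · simp at hij
    · exact hadj i j
    · exact (hadj j i).symm
    · simp at hij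
  · refine Function.Injective.sumElim ?_ (Subtype.val_injective.comp e.injective)
      fun i j => (hadj i j).ne
    intro i j hij
    fin_cases i <;> fin_cases j <;> simp_all [Ne.symm]

open Finset in
/-- A graph with average degree greater than `m - 1` and all codegrees at most `m / 12` contains
every tree with `m` edges. -/
theorem SimpleGraph.IsTree.exists_injective_hom_of_codegree_le {V : Type*} [Fintype V]
    [DecidableEq V] (G : SimpleGraph V) [DecidableRel G.Adj] {m l : ℕ} (hm1 : 1 ≤ m)
    (hlm : 12 * l ≤ m)
    (hco : ∀ a b, a ≠ b → #(G.neighborFinset a ∩ G.neighborFinset b) ≤ l)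
    (hedges : m * Fintype.card V < 2 * #G.edgeFinset + Fintype.card V)
    {W : Type*} [Fintype W] {T : SimpleGraph W} (hT : T.IsTree) (hW : Fintype.card W = m + 1) :
    ∃ f : T →g G, Function.Injective f := by
  classical
  obtain ⟨U, hU, v, hvU, hv⟩ := G.exists_induced_degree_bounds hedges
  obtain ⟨p, par, depth, hdp, hdepth, hedge, hmax⟩ := hT.exists_rooted
  suffices hg : ∃ g : W → V, Function.Injective g ∧ ∀ x, x ≠ p → G.Adj (g (par x)) (g x) by
    obtain ⟨g, hginj, hg⟩ := hg
    refine ⟨⟨g, fun {a b} hab => ?_⟩, hginj⟩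
    rcases hedge a b hab with ⟨h, rfl⟩ | ⟨h, rfl⟩
    · exact hg b h
    · exact (hg a h).symm
  rcases Nat.eq_zero_or_pos l with rfl | hl
  · obtain ⟨z, hz⟩ : (G.neighborFinset v ∩ U).Nonempty := card_pos.1 (by omega)
    have hvz : G.Adj v z := (mem_neighborFinset _ _ _).1 (mem_inter.1 hz).1
    have hm : m ≤ 1 := by
      by_contra! hm
      obtain ⟨a, ha, b, hb, hab⟩ := one_lt_card.1 (hm.trans_le hv)
      have := hco a b hab
      rw [Nat.le_zero, card_eq_zero] at this
      refine notMem_empty v (this ▸ ?_)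
      simp only [mem_inter, mem_neighborFinset] at ha hb ⊢
      exact ⟨ha.1.symm, hb.1.symm⟩
    have huniq : ∀ x y, x ≠ p → y ≠ p → x = y := by
      intro x y hx hy
      by_contra hxy
      have := card_le_univ ({x, y, p} : Finset W)
      rw [card_eq_three.2 ⟨x, y, p, hxy, hx, hy, rfl⟩] at this
      omega
    refine ⟨fun x => if x = p then v else z, fun x y hxy => ?_, fun x hx => ?_⟩
    · by_cases hx : x = p <;> by_cases hy : y = p
      · rw [hx, hy]
      · simp [hx, hy, hvz.ne] at hxy
      · simp [hx, hy, hvz.ne'] at hxy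
      · exact huniq x y hx hy
    · have hpx : par x = p := by
        by_contra h
        have h1 := hdepth x hx
        rw [huniq _ _ h hx] at h1
        omega
      simpa [hpx, hx] using hvz
  · let H : SimpleGraph U := G.comap Subtype.val
    have hmap : ∀ x : U, (H.neighborFinset x).map (Function.Embedding.subtype _) =
        G.neighborFinset x ∩ U := by
      intro x
      ext y
      simp [H, and_comm]
    have hdegH : ∀ x : U, H.degree x = #(G.neighborFinset x ∩ U) := fun x => by
      rw [← hmap, card_map, card_neighborFinset_eq_degree]
    obtain ⟨g, hginj, hg⟩ := exists_embedding H (m := m) (l := l) (v := ⟨v, hvU⟩)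
      (fun x => (hdegH x).symm ▸ hU x x.2)
      (fun a b hab => by
        rw [← card_map (Function.Embedding.subtype _), map_inter, hmap, hmap]
        exact (card_le_card (inter_subset_inter inter_subset_left inter_subset_left)).trans
          (hco a b (Subtype.coe_ne_coe.2 hab)))
      hl hlm ((hdegH _).symm ▸ hv) hdp hdepth hW hmax
    exact ⟨fun x => g x, Subtype.val_injective.comp hginj, hg⟩

/-- Balasubramanian–Dobson: the Erdős–Sós conjecture holds for graphs containing
no copy of `K_{2,s}` with `s < k/12 + 1`. -/
theorem erdos_sos_no_K2s {V : Type*} [Fintype V] (G : SimpleGraph V) [DecidableRel G.Adj]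
    (k s : ℕ) (hk : 2 ≤ k) (hs : 0 < s) (hsk : (s : ℝ) < k / 12 + 1)
    (hK2s : ¬ ∃ f : completeBipartiteGraph (Fin 2) (Fin s) →g G, Function.Injective f)
    (havg : (k : ℝ) - 2 < 2 * G.edgeFinset.card / Fintype.card V) :
    ∀ (W : Type) [Fintype W] (T : SimpleGraph W), T.IsTree → Fintype.card W = k →
      ∃ f : T →g G, Function.Injective f := by
  classical
  intro W _ T hT hW
  obtain ⟨m, rfl⟩ : ∃ m, k = m + 1 := ⟨k - 1, by omega⟩
  obtain ⟨l, rfl⟩ : ∃ l, s = l + 1 := ⟨s - 1, by omega⟩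
  refine hT.exists_injective_hom_of_codegree_le G (m := m) (l := l) (by omega) ?_
    (fun a b hab => Nat.lt_succ_iff.1 (G.card_inter_neighborFinset_lt_of_K2s_free hK2s hab)) ?_ hW
  · have : (12 * l : ℝ) < m + 1 := by push_cast at hsk; linarith
    exact Nat.lt_succ_iff.1 (by exact_mod_cast this)
  · rcases Nat.eq_zero_or_pos (Fintype.card V) with h0 | h0
    · have h1 : (2 : ℝ) ≤ (m + 1 : ℕ) := by exact_mod_cast hk
      rw [h0, Nat.cast_zero, div_zero] at havg
      linarith
    · have h1 : (0 : ℝ) < Fintype.card V := by exact_mod_cast h0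
      rw [lt_div_iff₀ h1] at havg
      have h2 : (m * Fintype.card V : ℝ) < 2 * G.edgeFinset.card + Fintype.card V := by
        push_cast at havg; linarith
      exact_mod_cast h2
end

section
/- Let k ≥ 2 and let G be a finite simple graph of order n whose average degree 2·e(G)/n is strictly greater than k−2, and suppose the complement graph of G has girth at least 5. Then G contains every tree of order k as a subgraph. -/
open SimpleGraph

namespace SimpleGraph

/-- A finite nonempty forest has a vertex with at most one neighbour. -/
theorem IsAcyclic.exists_subsingleton_neighborSet {W : Type*} [Finite W] [Nonempty W]
    {T : SimpleGraph W} (hT : T.IsAcyclic) : ∃ v, (T.neighborSet v).Subsingleton := by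
  have ⟨u, v, p, hp, hmax⟩ := Walk.exists_isPath_forall_isPath_length_le_length T
  have key : ∀ w, T.Adj u w → w = p.snd := fun w hadj ↦ by
    apply hT.eq_snd_of_adj_start hp hadj
    have : ¬(p.cons hadj.symm).IsPath := by grind [Walk.length_cons]
    grind [hp.cons]
  exact ⟨u, fun x hx y hy ↦ (key x hx).trans (key y hy).symm⟩

/-- A forest packs with any graph on equally many vertices with fewer than half as many edges
as vertices; here the count of ordered adjacent pairs is twice the number of edges. -/
theorem IsAcyclic.exists_injOn_not_adj {W V : Type*} [DecidableEq W] [DecidableEq V]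
    {T : SimpleGraph W} (hT : T.IsAcyclic) (H : SimpleGraph V) [DecidableRel H.Adj]
    (n : ℕ) (A : Finset W) (B : Finset V) (hA : A.card = n) (hB : B.card = n)
    (hH : ((B ×ˢ B).filter fun e ↦ H.Adj e.1 e.2).card < n) :
    ∃ f : W → V, Set.MapsTo f A B ∧ Set.InjOn f A ∧
      ∀ x ∈ A, ∀ y ∈ A, T.Adj x y → ¬ H.Adj (f x) (f y) := by
  induction n using Nat.strong_induction_on generalizing A B with
  | _ n ih =>
  by_cases hedge : ∃ x ∈ B, ∃ y ∈ B, H.Adj x y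
  · obtain ⟨x, hx, y, hy, hxy⟩ := hedge
    obtain ⟨v, hv, hiso⟩ : ∃ v ∈ B, ∀ z ∈ B, ¬ H.Adj v z := by
      by_contra! hcon
      choose! g hg hg' using hcon
      have : B.card ≤ ((B ×ˢ B).filter fun e ↦ H.Adj e.1 e.2).card :=
        Finset.card_le_card_of_injOn (fun b ↦ (b, g b)) (by intro b hb; simp_all)
          (by intro a _ b _ h; exact congrArg Prod.fst h)
      omega
    have hvx : v ≠ x := by rintro rfl; exact hiso y hy hxy
    have hne : A.Nonempty := Finset.card_pos.1 (by omega)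
    have : Nonempty (A : Set W) := hne.to_subtype
    obtain ⟨⟨l, hl⟩, hleaf⟩ := (hT.induce (A : Set W)).exists_subsingleton_neighborSet
    have hl' : l ∈ A := hl
    have hleaf' : ∀ a ∈ A, ∀ b ∈ A, T.Adj l a → T.Adj l b → a = b := fun a ha b hb h1 h2 ↦
      congrArg Subtype.val (@hleaf ⟨a, ha⟩ h1 ⟨b, hb⟩ h2)
    have hB2 : 2 ≤ B.card := by
      have := Finset.card_le_card (show {v, x} ⊆ B by grind)
      rwa [Finset.card_pair hvx] at this
    obtain ⟨p, hp, hpl, hpn⟩ : ∃ p ∈ A, p ≠ l ∧ ∀ a ∈ A, T.Adj l a → a = p := by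
      by_cases h : ∃ a ∈ A, T.Adj l a
      · obtain ⟨a, ha, hadj⟩ := h
        exact ⟨a, ha, hadj.ne', fun b hb hb' ↦ hleaf' b hb a ha hb' hadj⟩
      · obtain ⟨p, hp, hpl⟩ := Finset.exists_mem_ne (by omega : 1 < A.card) l
        exact ⟨p, hp, hpl, fun a ha h' ↦ (h ⟨a, ha, h'⟩).elim⟩
    obtain ⟨f, hf1, hf2, hf3⟩ := ih (n - 2) (by omega) ((A.erase l).erase p)
      ((B.erase x).erase v) (by grind) (by grind) (by
        have hsub : ((((B.erase x).erase v) ×ˢ ((B.erase x).erase v)).filter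
            fun e ↦ H.Adj e.1 e.2) ∪ {(x, y), (y, x)} ⊆
            (B ×ˢ B).filter fun e ↦ H.Adj e.1 e.2 := by
          intro e he
          have := hxy.symm
          simp only [Finset.mem_union, Finset.mem_filter, Finset.mem_product, Finset.mem_erase,
            Finset.mem_insert, Finset.mem_singleton] at he ⊢
          rcases he with he | rfl | rfl <;> tauto
        have hcard := Finset.card_le_card hsub
        rw [Finset.card_union_of_disjoint (by
          rw [Finset.disjoint_left]
          intro e he
          simp only [Finset.mem_filter, Finset.mem_product, Finset.mem_erase,
            Finset.mem_insert, Finset.mem_singleton] at he ⊢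
          rintro (rfl | rfl) <;> tauto), Finset.card_pair (by
            intro h; exact hxy.ne (congrArg Prod.fst h))] at hcard
        omega)
    have hf1' : ∀ a ∈ A, a ≠ l → a ≠ p → f a ∈ B ∧ f a ≠ x ∧ f a ≠ v := by
      intro a ha h1 h2
      have := hf1 (x := a) (by simp [ha, h1, h2])
      simp at this
      tauto
    have hf2' : ∀ a ∈ A, a ≠ l → a ≠ p → ∀ b ∈ A, b ≠ l → b ≠ p → f a = f b → a = b :=
      fun a ha h1 h2 b hb h3 h4 h ↦ hf2 (by simp [ha, h1, h2]) (by simp [hb, h3, h4]) h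
    have hiso' : ∀ z ∈ B, ¬ H.Adj z v := fun z hz h ↦ hiso z hz h.symm
    refine ⟨fun a ↦ if a = l then x else if a = p then v else f a, ?_, ?_, ?_⟩
    · intro a ha
      have ha' : a ∈ A := ha
      have := hf1' a ha'
      change (if a = l then x else if a = p then v else f a) ∈ B
      grind
    · intro a ha b hb h
      have ha' : a ∈ A := ha
      have hb' : b ∈ A := hb
      grind
    · intro a ha b hb hab
      have h1 := hf3 a
      have h2 := hab.ne
      have h3 := hab.symm
      simp only [Finset.mem_erase] at h1
      grind
  · push Not at hedge
    obtain ⟨b, hb⟩ : B.Nonempty := Finset.card_pos.1 (by omega)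
    have : Nonempty V := ⟨b⟩
    have hAB : (A : Set W).encard ≤ (B : Set V).encard := by simp [hA, hB]
    obtain ⟨f, hf, hinj⟩ := (Finset.finite_toSet A).exists_injOn_of_encard_le hAB
    exact ⟨f, hf, hinj, fun x hx y hy _ ↦ hedge _ (hf hx) _ (hf hy)⟩

/-- In a connected graph, two adjacent vertices of degree one are the only vertices. -/
theorem Connected.eq_or_eq_of_adj_of_degree_eq_one {W : Type*} [Fintype W] {T : SimpleGraph W}
    [DecidableRel T.Adj] (hT : T.Connected) {x y : W} (hxy : T.Adj x y) (hx : T.degree x = 1)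
    (hy : T.degree y = 1) (z : W) : z = x ∨ z = y := by
  rw [degree_eq_one_iff_existsUnique_adj] at hx hy
  obtain ⟨w⟩ := hT.preconnected z x
  induction w with
  | nil => exact .inl rfl
  | cons h _ ih =>
    rcases ih hxy hx with rfl | rfl
    · exact .inr (hx.unique h.symm hxy)
    · exact .inl (hy.unique h.symm hxy.symm)

/-- A finite tree is a star, or it has two distinct vertices that are not leaves and all but at
most one of whose neighbours are leaves. -/
theorem IsTree.exists_center_or_exists_pair {W : Type*} [Fintype W] {T : SimpleGraph W}
    [DecidableRel T.Adj] (hT : T.IsTree) :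
    (∃ c, ∀ x y, T.Adj x y → x = c ∨ y = c) ∨
      ∃ p q, p ≠ q ∧ ∀ r, r = p ∨ r = q → 2 ≤ T.degree r ∧
        T.degree r ≤ ((T.neighborFinset r).filter fun x ↦ T.degree x = 1).card + 1 := by
  classical
  by_cases hadj : ∃ x y, T.Adj x y ∧ T.degree x = 1 ∧ T.degree y = 1
  · obtain ⟨x, y, hxy, hx, hy⟩ := hadj
    have := hT.connected.eq_or_eq_of_adj_of_degree_eq_one hxy hx hy
    refine .inl ⟨x, fun a b hab ↦ ?_⟩
    rcases this a with rfl | rfl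
    · exact .inl rfl
    · exact .inr ((this b).resolve_right hab.ne')
  push Not at hadj
  obtain ⟨w⟩ := hT.connected.nonempty
  set s : Set W := {v | T.degree v ≠ 1} with hs
  by_cases hsub : s.Subsingleton
  · left
    rcases s.eq_empty_or_nonempty with he | ⟨c, hc⟩
    · refine ⟨w, fun x y hxy ↦ ?_⟩
      have hleaf : ∀ v, T.degree v = 1 := fun v ↦ by
        by_contra hv
        exact Set.eq_empty_iff_forall_notMem.1 he v hv
      exact (hadj x y hxy (hleaf x) (hleaf y)).elim
    · refine ⟨c, fun x y hxy ↦ ?_⟩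
      by_cases hx : x ∈ s
      · exact .inl (hsub hx hc)
      · exact .inr (hsub (hadj x y hxy (by simpa [hs] using hx)) hc)
  right
  rw [Set.not_subsingleton_iff] at hsub
  have : Nontrivial s := hsub.coe_sort
  have hW : Nontrivial W := ⟨_, _, hsub.choose_spec.2.choose_spec.2⟩
  have htree : (T.induce s).IsTree := by
    refine ⟨⟨hT.connected.preconnected.induce_of_degree_eq_one fun v hv ↦ ?_⟩,
      hT.isAcyclic.induce s⟩
    have hv : T.degree v = 1 := by simpa [hs] using hv
    rw [degree_eq_one_iff_existsUnique_adj] at hv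
    exact fun a ha b hb ↦ hv.unique ha hb
  obtain ⟨⟨p, hp⟩, ⟨q, hq⟩, hpq, hp1, hq1⟩ := htree.exists_ne_and_degree_eq_one
  have key : ∀ r (hr : r ∈ s), (T.induce s).degree ⟨r, hr⟩ = 1 → 2 ≤ T.degree r ∧
      T.degree r ≤ ((T.neighborFinset r).filter fun x ↦ T.degree x = 1).card + 1 := by
    intro r hr h1
    rw [degree_eq_one_iff_existsUnique_adj] at h1
    obtain ⟨⟨a, ha⟩, -, hua⟩ := h1
    have h0 := hT.connected.preconnected.degree_pos_of_nontrivial r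
    have hr' : T.degree r ≠ 1 := hr
    refine ⟨by omega, ?_⟩
    rw [← card_neighborFinset_eq_degree, ← Finset.card_filter_add_card_filter_not
      (s := T.neighborFinset r) (fun x ↦ T.degree x = 1)]
    gcongr
    rw [Finset.card_le_one_iff_subset_singleton]
    refine ⟨a, fun b hb ↦ ?_⟩
    simp only [Finset.mem_filter, mem_neighborFinset] at hb
    exact Finset.mem_singleton.2 (congrArg Subtype.val (hua ⟨b, hb.2⟩ hb.1))
  exact ⟨p, q, fun h ↦ hpq (Subtype.ext h), by
    rintro r (rfl | rfl)
    exacts [key _ hp hp1, key _ hq hq1]⟩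

/-- Suppose the complement of `G` has no triangle and no four-cycle. An embedding in `G` of a tree
minus the leaf `l` at `p` yields an embedding of the whole tree, provided that some other vertex
`q` has at least `T.degree p - 1` leaves attached to it. -/
theorem exists_extension_of_leaf {W V : Type*} [Fintype W] [Fintype V] {T : SimpleGraph W}
    {G : SimpleGraph V} [DecidableRel T.Adj]
    (h3 : ∀ a b c, Gᶜ.Adj a b → Gᶜ.Adj a c → ¬ Gᶜ.Adj b c)
    (h4 : ∀ a b x y, Gᶜ.Adj a x → Gᶜ.Adj a y → Gᶜ.Adj b x → Gᶜ.Adj b y → x ≠ y → a = b)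
    (hcard : Fintype.card W < Fintype.card V) {p q l : W} (hpq : p ≠ q) (hql : q ≠ l)
    (hl : ∀ y, T.Adj l y ↔ y = p) {L : Finset W} (hL : ∀ x ∈ L, ∀ y, T.Adj x y ↔ y = q)
    (hdeg : T.degree p ≤ L.card + 1) {f : W → V} (hinj : Set.InjOn f {l}ᶜ)
    (hf : ∀ x y, x ≠ l → y ≠ l → T.Adj x y → G.Adj (f x) (f y)) :
    ∃ g : T →g G, Function.Injective g := by
  classical
  suffices ∃ g : W → V, Function.Injective g ∧ ∀ x y, T.Adj x y → G.Adj (g x) (g y) by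
    obtain ⟨g, hg, hg'⟩ := this
    exact ⟨⟨g, fun {x y} h ↦ hg' x y h⟩, hg⟩
  by_contra hcon
  have hpl : T.Adj l p := (hl p).2 rfl
  have hplne := hpl.ne
  have hlL : l ∉ L := fun h ↦ hpq ((hL l h p).1 hpl)
  have hpL : p ∉ L := fun h ↦ hql ((hL p h l).1 hpl.symm).symm
  have hinj' : ∀ x y, x ≠ l → y ≠ l → f x = f y → x = y := fun x y hx hy h ↦ hinj hx hy h
  set U : Finset V := Finset.univ \ (Finset.univ.erase l).image f with hU
  have hUf : ∀ w ∈ U, ∀ x, x ≠ l → f x ≠ w := by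
    intro w hw x hx h
    simp only [hU, Finset.mem_sdiff, Finset.mem_image, Finset.mem_erase] at hw
    exact hw.2 ⟨x, ⟨hx, Finset.mem_univ _⟩, h⟩
  have hUcard : 1 < U.card := by
    have h1 := Finset.card_image_le (s := Finset.univ.erase l) (f := f)
    rw [Finset.card_erase_of_mem (Finset.mem_univ _), Finset.card_univ] at h1
    have h2 := Finset.le_card_sdiff ((Finset.univ.erase l).image f) Finset.univ
    rw [Finset.card_univ] at h2
    have : 0 < Fintype.card W := Fintype.card_pos_iff.2 ⟨l⟩
    rw [hU]
    omega
  clear_value U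
  clear hU
  have hUadj : ∀ w ∈ U, Gᶜ.Adj (f p) w := by
    intro w hw
    rw [compl_adj]
    refine ⟨hUf w hw p hplne.symm, fun hadj ↦ hcon ⟨fun x ↦ if x = l then w else f x, ?_, ?_⟩⟩
    · intro x y h
      clear h3 h4
      grind
    · intro x y h
      have := h.symm
      have := hadj.symm
      have := h.ne
      clear h3 h4
      grind
  have hgood : ∀ r, r ≠ l → r ≠ p → ∃ w ∈ U, G.Adj (f r) w := by
    intro r hrl hrp
    obtain ⟨a, ha, b, hb, hab⟩ := Finset.one_lt_card.1 hUcard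
    by_contra! hno
    refine hrp (hinj' r p hrl hplne.symm (h4 _ _ a b ?_ ?_ (hUadj a ha) (hUadj b hb) hab))
    · exact (compl_adj ..).2 ⟨hUf a ha r hrl, hno a ha⟩
    · exact (compl_adj ..).2 ⟨hUf b hb r hrl, hno b hb⟩
  obtain ⟨a, ha, hqa⟩ := hgood q hql hpq.symm
  have hLadj : ∀ y ∈ L, Gᶜ.Adj (f p) (f y) := by
    intro y hy
    have hyl : y ≠ l := fun h ↦ hlL (h ▸ hy)
    have hyp : y ≠ p := fun h ↦ hpL (h ▸ hy)
    have hLy := hL y hy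
    rw [compl_adj]
    refine ⟨fun h ↦ hyp (hinj' _ _ hyl hplne.symm h.symm), fun hadj ↦
      hcon ⟨fun x ↦ if x = l then f y else if x = y then a else f x, ?_, ?_⟩⟩
    · intro x z h
      clear h3 h4
      grind
    · intro x z h
      have := h.symm
      have := hadj.symm
      have := hqa.symm
      have := h.ne
      clear h3 h4
      grind
  have hSadj : ∀ w ∈ U ∪ L.image f, Gᶜ.Adj (f p) w := by
    intro w hw
    rcases Finset.mem_union.1 hw with hw | hw
    · exact hUadj w hw
    · obtain ⟨y, hy, rfl⟩ := Finset.mem_image.1 hw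
      exact hLadj y hy
  have hScard : L.card + 2 ≤ (U ∪ L.image f).card := by
    rw [Finset.card_union_of_disjoint, Finset.card_image_of_injOn]
    · omega
    · intro x hx y hy h
      exact hinj' x y (fun h ↦ hlL (h ▸ hx)) (fun h ↦ hlL (h ▸ hy)) h
    · rw [Finset.disjoint_left]
      intro w hw hw'
      obtain ⟨y, hy, rfl⟩ := Finset.mem_image.1 hw'
      exact hUf _ hw y (fun h ↦ hlL (h ▸ hy)) rfl
  obtain ⟨w, hw, hwN⟩ : ∃ w ∈ U ∪ L.image f, ∀ x, T.Adj p x → x ≠ l → ¬ Gᶜ.Adj (f x) w := by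
    have : Nonempty W := ⟨l⟩
    by_contra! hblock
    choose! b hb hbl hbadj using hblock
    have : (U ∪ L.image f).card ≤ ((T.neighborFinset p).erase l).card := by
      refine Finset.card_le_card_of_injOn b (fun w hw ↦ ?_) (fun w hw w' hw' h ↦ ?_)
      · simpa using ⟨hb w hw, hbl w hw⟩
      · by_contra hne
        have h1 := hbadj w hw
        have h2 := hbadj w' hw'
        rw [← h] at h2
        have := h4 _ _ w w' h1 h2 (hSadj w hw) (hSadj w' hw') hne
        exact (hb w hw).ne' (hinj' _ _ (hbl w hw) hplne.symm this)
    rw [Finset.card_erase_of_mem (by simpa using hpl.symm), card_neighborFinset_eq_degree] at this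
    omega
  have hclique : ∀ w w', Gᶜ.Adj (f p) w → Gᶜ.Adj (f p) w' → w ≠ w' → G.Adj w w' := by
    intro w w' h h' hne
    by_contra hn
    exact h3 _ _ _ h h' ((compl_adj ..).2 ⟨hne, hn⟩)
  have hwN' : ∀ x, T.Adj p x → x ≠ l → G.Adj (f x) w := by
    intro x hx hxl
    by_contra hn
    refine hwN x hx hxl ((compl_adj ..).2 ⟨?_, hn⟩)
    rintro rfl
    rcases Finset.mem_union.1 hw with hw | hw
    · exact hUf _ hw x hxl rfl
    · obtain ⟨y, hy, hyx⟩ := Finset.mem_image.1 hw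
      obtain rfl := hinj' _ _ (fun h ↦ hlL (h ▸ hy)) hxl hyx
      exact hpq ((hL _ hy p).1 hx.symm)
  clear h3 h4 hgood hwN hScard hSadj hcard hdeg hinj
  rcases Finset.mem_union.1 hw with hwU | hwL
  · obtain ⟨b, hb, hbw⟩ := Finset.exists_mem_ne hUcard w
    have hadj := hclique w b (hUadj w hwU) (hUadj b hb) hbw.symm
    refine hcon ⟨fun x ↦ if x = l then b else if x = p then w else f x, ?_, ?_⟩
    · intro x z h
      grind
    · intro x z h
      have := h.symm
      have := hadj.symm
      have := h.ne
      have := fun y (h : T.Adj p y) h' ↦ (hwN' y h h').symm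
      grind
  · obtain ⟨y, hy, rfl⟩ := Finset.mem_image.1 hwL
    have hyl : y ≠ l := fun h ↦ hlL (h ▸ hy)
    have hyp : y ≠ p := fun h ↦ hpL (h ▸ hy)
    obtain ⟨b, hb, hba⟩ := Finset.exists_mem_ne hUcard a
    have hadj := hclique (f y) b (hLadj y hy) (hUadj b hb) (hUf b hb y hyl)
    have hLy := hL y hy
    refine hcon ⟨fun x ↦ if x = l then b else if x = p then f y else if x = y then a else f x,
      ?_, ?_⟩
    · intro x z h
      grind
    · intro x z h
      clear hw hwL hclique hUf hUadj hinj'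
      have := h.symm
      have := hadj.symm
      have := hqa.symm
      have := h.ne
      have := fun y (h : T.Adj p y) h' ↦ (hwN' y h h').symm
      grind

/-- If the complement of `G` has no triangle and no four-cycle, then `G` contains every tree
of order less than that of `G` and at most one more than some degree of `G`. -/
theorem exists_hom_injective_of_card_lt {V : Type*} [Fintype V] {G : SimpleGraph V}
    [DecidableRel G.Adj]
    (h3 : ∀ a b c, Gᶜ.Adj a b → Gᶜ.Adj a c → ¬ Gᶜ.Adj b c)
    (h4 : ∀ a b x y, Gᶜ.Adj a x → Gᶜ.Adj a y → Gᶜ.Adj b x → Gᶜ.Adj b y → x ≠ y → a = b)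
    (k : ℕ) (hk : k < Fintype.card V) {v : V} (hv : k ≤ G.degree v + 1)
    {W : Type*} [Fintype W] {T : SimpleGraph W} (hT : T.IsTree) (hW : Fintype.card W = k) :
    ∃ f : T →g G, Function.Injective f := by
  classical
  induction k generalizing W with
  | zero =>
    have := hT.connected.nonempty
    exact (Fintype.card_ne_zero hW).elim
  | succ k ih =>
  rcases hT.exists_center_or_exists_pair with ⟨c, hc⟩ | ⟨p, q, hpq, h⟩
  · have hle : (({c}ᶜ : Finset W) : Set W).encard ≤ (G.neighborFinset v : Set V).encard := by
      rw [Set.encard_coe_eq_coe_finsetCard, Set.encard_coe_eq_coe_finsetCard,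
        Finset.card_compl, Finset.card_singleton, card_neighborFinset_eq_degree]
      exact_mod_cast by omega
    have : Nonempty V := ⟨v⟩
    obtain ⟨f, hf, hinj⟩ := (Finset.finite_toSet _).exists_injOn_of_encard_le hle
    have hf' : ∀ x, x ≠ c → G.Adj v (f x) := fun x hx ↦ by
      simpa using hf (show x ∈ _ by simpa using hx)
    have hinj' : ∀ x y, x ≠ c → y ≠ c → f x = f y → x = y := fun x y hx hy h ↦
      hinj (by simpa using hx) (by simpa using hy) h
    have hfv : ∀ x, x ≠ c → f x ≠ v := fun x hx ↦ (hf' x hx).ne'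
    refine ⟨⟨fun x ↦ if x = c then v else f x, fun {x y} hxy ↦ ?_⟩, fun x y hxy ↦ ?_⟩
    · have := hxy.ne
      have := hc x y hxy
      have := fun x hx ↦ (hf' x hx).symm
      grind
    · change (if x = c then v else f x) = if y = c then v else f y at hxy
      grind
  · wlog hle : ((T.neighborFinset p).filter fun x ↦ T.degree x = 1).card ≤
        ((T.neighborFinset q).filter fun x ↦ T.degree x = 1).card generalizing p q
    · exact this q p hpq.symm (fun r hr ↦ h r hr.symm) (le_of_not_ge hle)
    obtain ⟨hp2, hp⟩ := h p (.inl rfl)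
    obtain ⟨hq2, -⟩ := h q (.inr rfl)
    have hleaf : ∀ r, ∀ x ∈ (T.neighborFinset r).filter fun x ↦ T.degree x = 1,
        ∀ y, T.Adj x y ↔ y = r := by
      intro r x hx y
      simp only [Finset.mem_filter, mem_neighborFinset, degree_eq_one_iff_existsUnique_adj] at hx
      exact ⟨fun h ↦ hx.2.unique h hx.1.symm, fun h ↦ h ▸ hx.1.symm⟩
    obtain ⟨l, hl⟩ := Finset.card_pos.1
      (show 0 < ((T.neighborFinset p).filter fun x ↦ T.degree x = 1).card by omega)
    have hl1 : T.degree l = 1 := (Finset.mem_filter.1 hl).2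
    have htree : (T.induce {l}ᶜ).IsTree :=
      ⟨hT.connected.induce_compl_singleton_of_degree_eq_one hl1, hT.isAcyclic.induce _⟩
    obtain ⟨f, hf⟩ := ih (by omega) (by omega) htree (by
      have := Fintype.card_subtype_compl (fun x ↦ x = l)
      rw [Fintype.card_subtype_eq, hW] at this
      exact this)
    refine exists_extension_of_leaf h3 h4 (by omega) hpq (by rintro rfl; omega) (hleaf p l hl)
      (hleaf q) (hp.trans (by omega))
      (f := fun x ↦ if hx : x ≠ l then f ⟨x, hx⟩ else v) ?_ ?_
    · intro x hx y hy hxy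
      simp only [Set.mem_compl_iff, Set.mem_singleton_iff] at hx hy
      simp only [ne_eq, hx, hy, not_false_eq_true, dite_true] at hxy
      exact congrArg Subtype.val (hf hxy)
    · intro x y hx hy hxy
      simp only [ne_eq, hx, hy, not_false_eq_true, dite_true]
      exact f.map_rel hxy

/-- A forest embeds in any graph of the same order whose complement has degree sum less than
the order. -/
theorem IsAcyclic.exists_hom_injective_of_sum_compl_degree_lt {W V : Type*}
    [Fintype W] [Fintype V] {T : SimpleGraph W} (hT : T.IsAcyclic) {G : SimpleGraph V}
    [DecidableRel G.Adj] (hcard : Fintype.card W = Fintype.card V)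
    (hdeg : ∑ v, (Fintype.card V - 1 - G.degree v) < Fintype.card V) :
    ∃ f : T →g G, Function.Injective f := by
  classical
  obtain ⟨f, -, hinj, hf⟩ := hT.exists_injOn_not_adj Gᶜ (Fintype.card V) Finset.univ Finset.univ
    hcard rfl (by
      refine lt_of_eq_of_lt ?_ hdeg
      rw [Finset.card_filter, Finset.sum_product]
      refine Finset.sum_congr rfl fun v _ ↦ ?_
      rw [← degree_compl, ← card_neighborFinset_eq_degree, neighborFinset_eq_filter,
        Finset.card_filter])
  have hinj' : Function.Injective f := by simpa using hinj
  refine ⟨⟨f, fun {x y} hxy ↦ ?_⟩, hinj'⟩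
  by_contra hn
  exact hf x (by simp) y (by simp) hxy ((compl_adj ..).2 ⟨hinj'.ne hxy.ne, hn⟩)

theorem not_adj_of_four_le_egirth_s3 {V : Type*} {H : SimpleGraph V} (hH : 4 ≤ H.egirth)
    {a b c : V} (hab : H.Adj a b) (hac : H.Adj a c) : ¬ H.Adj b c := by
  intro hbc
  have hcyc : (Walk.cons hab (.cons hbc (.cons hac.symm .nil))).IsCycle := by
    have := hab.ne
    have := hac.ne
    have := hbc.ne
    simp [Walk.isCycle_def, Walk.isTrail_def]
    grind
  have := hH.trans (egirth_le_length hcyc)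
  simp only [Walk.length_cons, Walk.length_nil] at this
  norm_cast at this

theorem eq_of_adj_of_five_le_egirth {V : Type*} {H : SimpleGraph V} (hH : 5 ≤ H.egirth)
    {a b x y : V} (hax : H.Adj a x) (hay : H.Adj a y) (hbx : H.Adj b x) (hby : H.Adj b y)
    (hxy : x ≠ y) : a = b := by
  by_contra hab
  have hcyc : (Walk.cons hax (.cons hbx.symm (.cons hby (.cons hay.symm .nil)))).IsCycle := by
    have := hax.ne
    have := hay.ne
    have := hbx.ne
    have := hby.ne
    simp [Walk.isCycle_def, Walk.isTrail_def]
    grind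
  have := hH.trans (egirth_le_length hcyc)
  simp only [Walk.length_cons, Walk.length_nil] at this
  norm_cast at this

end SimpleGraph

/-- Li–Liu–Wang: the Erdős–Sós conjecture holds for graphs whose complement has
girth at least 5. -/
theorem erdos_sos_complement_girth_five {V : Type*} [Fintype V] (G : SimpleGraph V)
    [DecidableRel G.Adj] (k : ℕ) (hk : 2 ≤ k)
    (hgirth : 5 ≤ (Gᶜ).egirth)
    (havg : (k : ℝ) - 2 < 2 * G.edgeFinset.card / Fintype.card V) :
    ∀ (W : Type) [Fintype W] (T : SimpleGraph W), T.IsTree → Fintype.card W = k →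
      ∃ f : T →g G, Function.Injective f := by
  intro W _ T hT hW
  have hpos : 0 < Fintype.card V := by
    by_contra h0
    have : (2 : ℝ) ≤ k := by exact_mod_cast hk
    simp only [Nat.eq_zero_of_not_pos h0, Nat.cast_zero, div_zero] at havg
    linarith
  have hsum : (k - 2) * Fintype.card V < ∑ v, G.degree v := by
    rw [lt_div_iff₀ (by exact_mod_cast hpos)] at havg
    rw [sum_degrees_eq_twice_card_edges]
    zify [hk]
    exact_mod_cast havg
  obtain ⟨v, hv⟩ : ∃ v, k - 2 < G.degree v := by
    by_contra! hle
    have := Finset.sum_le_card_nsmul Finset.univ (fun v ↦ G.degree v) _ fun v _ ↦ hle v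
    rw [Finset.card_univ, smul_eq_mul, mul_comm] at this
    omega
  have hdeg : ∀ v, G.degree v ≤ Fintype.card V - 1 := fun v ↦
    Nat.le_sub_one_of_lt (G.degree_lt_card_verts v)
  rcases (show k ≤ Fintype.card V by have := hdeg v; omega).lt_or_eq with hlt | heq
  · exact exists_hom_injective_of_card_lt
      (fun _ _ _ hab hac ↦ not_adj_of_four_le_egirth_s3 (le_trans (by norm_num) hgirth) hab hac)
      (fun _ _ _ _ hax hay hbx hby ↦ eq_of_adj_of_five_le_egirth hgirth hax hay hbx hby)
      k hlt (v := v) (by omega) hT hW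
  · refine hT.isAcyclic.exists_hom_injective_of_sum_compl_degree_lt (hW.trans heq) ?_
    have hadd : ∑ v, (Fintype.card V - 1 - G.degree v) + ∑ v, G.degree v =
        Fintype.card V * (Fintype.card V - 1) := by
      rw [← Finset.sum_add_distrib, Finset.sum_congr rfl fun v _ ↦ Nat.sub_add_cancel (hdeg v)]
      simp
    obtain ⟨m, hm⟩ : ∃ m, Fintype.card V = m + 2 := ⟨k - 2, by omega⟩
    rw [heq, hm] at hsum
    rw [hm] at hadd ⊢
    simp only [Nat.add_sub_cancel, show m + 2 - 1 = m + 1 by omega] at hadd hsum ⊢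
    nlinarith
end

section
/- Let k ≥ 2 and let G be a finite simple graph of order n whose average degree 2·e(G)/n is strictly greater than k−2. Then G contains every tree of order k whose diameter is at most 4 as a subgraph. -/
open SimpleGraph

namespace SimpleGraph

lemma IsTree.length_eq_dist_of_isPath {W : Type*} {T : SimpleGraph W} (hT : T.IsTree) {u v : W}
    {p : T.Walk u v} (hp : p.IsPath) : p.length = T.dist u v := by
  obtain ⟨q, hq, hlen⟩ := hT.connected.exists_path_of_dist u v
  rw [(hT.existsUnique_path u v).unique hp hq, hlen]

lemma IsTree.dist_eq_add_of_adj {W : Type*} {T : SimpleGraph W} (hT : T.IsTree) {c p u v : W}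
    (hcp : T.Adj c p) (hu : T.dist c u = T.dist p u + 1) (hv : T.dist p v = T.dist c v + 1) :
    T.dist u v = T.dist c u + T.dist c v := by
  obtain ⟨q, hq⟩ := hT.connected.exists_walk_length_eq_dist p u
  obtain ⟨r, hr, hrlen⟩ := hT.connected.exists_path_of_dist c v
  have hq' : (Walk.cons hcp q).IsPath := by
    apply Walk.isPath_of_length_eq_dist
    simp [hq, hu]
  have hpath : ((Walk.cons hcp q).reverse.append r).IsPath := by
    rw [hT.isAcyclic.isPath_iff_isChain]
    cases r with
    | nil => simpa using (hT.isAcyclic.isPath_iff_isChain _).1 hq'.reverse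
    | @cons _ p' _ h' r' =>
      rw [Walk.edges_append, List.isChain_append]
      refine ⟨(hT.isAcyclic.isPath_iff_isChain _).1 hq'.reverse,
        (hT.isAcyclic.isPath_iff_isChain _).1 hr, ?_⟩
      have hne : p ≠ p' := by
        rintro rfl
        have := T.dist_le r'
        simp at hrlen
        omega
      simp only [Walk.reverse_cons, Walk.edges_append, Walk.edges_cons, Walk.edges_nil]
      simp [hne, hcp.ne']
  rw [← hT.length_eq_dist_of_isPath hpath]
  simp [hq, hu, hrlen]

/-- A finite tree of diameter at most `2 * n` has radius at most `n`. -/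
lemma IsTree.exists_forall_dist_le {W : Type*} [Fintype W] {T : SimpleGraph W} (hT : T.IsTree)
    {n : ℕ} (hd : ∀ u v, T.dist u v ≤ 2 * n) : ∃ c, ∀ w, T.dist c w ≤ n := by
  have := hT.connected.nonempty
  obtain ⟨c, hc⟩ := Finite.exists_min fun c : W ↦ Finset.univ.sup (T.dist c)
  refine ⟨c, fun w ↦ ?_⟩
  by_contra! hw
  obtain ⟨u, -, hu⟩ := Finset.exists_mem_eq_sup Finset.univ Finset.univ_nonempty (T.dist c)
  have hle : ∀ w, T.dist c w ≤ T.dist c u := fun w ↦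
    hu ▸ Finset.le_sup (f := T.dist c) (Finset.mem_univ w)
  have hwu := hle w
  obtain ⟨q, hq⟩ := hT.connected.exists_walk_length_eq_dist c u
  cases q with
  | nil => rw [T.dist_self] at hwu; omega
  | @cons _ p _ hcp q =>
    have h1 := T.dist_le q
    simp only [Walk.length_cons] at hq
    obtain ⟨v, -, hv⟩ := Finset.exists_mem_eq_sup Finset.univ Finset.univ_nonempty (T.dist p)
    have h2 : T.dist c u ≤ T.dist p v := by
      rw [← hu, ← hv]
      exact hc p
    have h3 := hT.dist_eq_dist_add_one_of_adj u hcp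
    have h4 := hT.dist_eq_dist_add_one_of_adj v hcp
    simp only [dist_comm (u := u), dist_comm (u := v)] at h3 h4
    have h5 := hle v
    have h6 := hT.dist_eq_add_of_adj (u := u) (v := v) hcp (by omega) (by omega)
    have := hd u v
    omega

/-- The stars with centers `y i` and leaf sets `A i` are pairwise vertex-disjoint stars of `G`. -/
structure IsStarForest {V ι : Type*} (G : SimpleGraph V) (y : ι → V) (A : ι → Finset V) :
    Prop where
  adj : ∀ i, ∀ z ∈ A i, G.Adj (y i) z
  center_injective : Function.Injective y
  center_notMem : ∀ i j, y i ∉ A j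
  eq_of_mem : ∀ i j z, z ∈ A i → z ∈ A j → i = j

namespace IsStarForest

variable {V ι : Type*} {G : SimpleGraph V} {y : ι → V} {A : ι → Finset V}

/-- Replace the `i`-th star by another one avoiding the remaining stars. -/
lemma replace [DecidableEq ι] (hF : G.IsStarForest y A) (i : ι) (c : V) (B : Finset V)
    (hc : ∀ k, k ≠ i → c ≠ y k ∧ c ∉ A k)
    (hB : ∀ z ∈ B, G.Adj c z ∧ ∀ k, k ≠ i → z ≠ y k ∧ z ∉ A k) :
    G.IsStarForest (Function.update y i c) (Function.update A i B) := by
  obtain ⟨h1, h2, h3, h4⟩ := hF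
  constructor
  · intro k z hz
    rcases eq_or_ne k i with rfl | hk
    · simp_all
    · simp_all
  · intro k l hkl
    have h : y k = y l → k = l := fun h ↦ h2 h
    by_cases hk : k = i <;> by_cases hl : l = i <;> grind [Function.update_apply]
  · intro k l hkl
    have h : c ∉ B := fun h ↦ (hB c h).1.ne rfl
    by_cases hk : k = i <;> by_cases hl : l = i <;> grind [Function.update_apply]
  · intro k l z hk hl
    grind [Function.update_apply]

/-- If partial star forests with centers in `N` can always be enlarged by a leaf, then there is a
star forest with centers in `N` and leaf numbers `a`. -/
lemma exists_of_grow [Fintype ι] [DecidableEq ι] (N : Finset V) (a : ι → ℕ)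
    (hN : Fintype.card ι ≤ N.card)
    (grow : ∀ (y : ι → V) (A : ι → Finset V), G.IsStarForest y A → (∀ i, y i ∈ N) →
      (∀ i, (A i).card ≤ a i) → ∀ j, (A j).card < a j →
      ∃ (y' : ι → V) (A' : ι → Finset V), G.IsStarForest y' A' ∧ (∀ i, y' i ∈ N) ∧
        ∀ i, (A' i).card = (A i).card + if i = j then 1 else 0) :
    ∃ (y : ι → V) (A : ι → Finset V), G.IsStarForest y A ∧ (∀ i, y i ∈ N) ∧
      ∀ i, (A i).card = a i := by
  have key : ∀ n ≤ ∑ i, a i, ∃ (y : ι → V) (A : ι → Finset V), G.IsStarForest y A ∧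
      (∀ i, y i ∈ N) ∧ (∀ i, (A i).card ≤ a i) ∧ ∑ i, (A i).card = n := by
    intro n
    induction n with
    | zero =>
      intro _
      obtain ⟨e⟩ : Nonempty (ι ↪ N) := Function.Embedding.nonempty_of_card_le (by simpa using hN)
      refine ⟨fun i ↦ e i, fun _ ↦ ∅, ⟨by simp, ?_, by simp, by simp⟩, by simp, by simp, by simp⟩
      exact Subtype.val_injective.comp e.injective
    | succ n ih =>
      intro hn
      obtain ⟨y, A, hF, hy, hA, hsum⟩ := ih (by omega)
      obtain ⟨j, -, hj⟩ : ∃ j ∈ Finset.univ, (A j).card < a j :=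
        Finset.exists_lt_of_sum_lt (by omega)
      obtain ⟨y', A', hF', hy', hA'⟩ := grow y A hF hy hA j hj
      refine ⟨y', A', hF', hy', fun i ↦ ?_, ?_⟩
      · rw [hA']
        split_ifs with h
        · exact h ▸ hj
        · exact hA i
      · simp [hA', Finset.sum_add_distrib, hsum]
  obtain ⟨y, A, hF, hy, hA, hsum⟩ := key _ le_rfl
  exact ⟨y, A, hF, hy, fun i ↦
    (Finset.sum_eq_sum_iff_of_le fun i _ ↦ hA i).1 hsum i (Finset.mem_univ i)⟩

/-- A new leaf can be added to the star with center `y j`. -/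
lemma exists_grow_of_adj [DecidableEq V] [DecidableEq ι] (hF : G.IsStarForest y A)
    {N : Finset V} (hy : ∀ i, y i ∈ N) (j : ι)
    {z : V} (hz : G.Adj (y j) z) (hzU : ∀ k, z ≠ y k ∧ z ∉ A k) :
    ∃ (y' : ι → V) (A' : ι → Finset V), G.IsStarForest y' A' ∧ (∀ i, y' i ∈ N) ∧
      ∀ i, (A' i).card = (A i).card + if i = j then 1 else 0 := by
  refine ⟨_, _, hF.replace j (y j) (insert z (A j)) ?_ ?_, ?_, ?_⟩
  · exact fun k hk ↦ ⟨fun h ↦ hk (hF.center_injective h).symm, hF.center_notMem j k⟩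
  · intro x hx
    rcases Finset.mem_insert.1 hx with rfl | hx
    · exact ⟨hz, fun k _ ↦ hzU k⟩
    · exact ⟨hF.adj j x hx, fun k hk ↦ ⟨fun h ↦ hF.center_notMem k j (h ▸ hx),
        fun h ↦ hk (hF.eq_of_mem k j x h hx)⟩⟩
  · simpa using hy
  · intro i
    rcases eq_or_ne i j with rfl | hi
    · simp [(hzU i).2]
    · simp [hi]

/-- The vertices covered by a family of stars. -/
def verts [Fintype ι] [DecidableEq V] (y : ι → V) (A : ι → Finset V) : Finset V :=
  Finset.univ.biUnion fun i ↦ insert (y i) (A i)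

lemma notMem_verts [Fintype ι] [DecidableEq V] {z : V} :
    z ∉ verts y A ↔ ∀ k, z ≠ y k ∧ z ∉ A k := by
  simp [verts]

lemma card_verts_le [Fintype ι] [DecidableEq V] (y : ι → V) (A : ι → Finset V) :
    (verts y A).card ≤ Fintype.card ι + ∑ i, (A i).card := by
  calc (verts y A).card ≤ ∑ i, (insert (y i) (A i)).card := Finset.card_biUnion_le
    _ ≤ ∑ i, (1 + (A i).card) :=
      Finset.sum_le_sum fun i _ ↦ (Finset.card_insert_le _ _).trans_eq (add_comm _ _)
    _ = _ := by simp [Finset.sum_add_distrib]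

/-- A star with many neighbors of its center can be enlarged. -/
lemma exists_grow_of_le_degree [Fintype V] [Fintype ι] [DecidableEq V] [DecidableEq ι]
    [DecidableRel G.Adj] (hF : G.IsStarForest y A) {N : Finset V} (hy : ∀ i, y i ∈ N) (j : ι)
    (hd : Fintype.card ι + ∑ i, (A i).card ≤ G.degree (y j)) :
    ∃ (y' : ι → V) (A' : ι → Finset V), G.IsStarForest y' A' ∧ (∀ i, y' i ∈ N) ∧
      ∀ i, (A' i).card = (A i).card + if i = j then 1 else 0 := by
  by_cases h : ∃ z, G.Adj (y j) z ∧ z ∉ verts y A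
  · obtain ⟨z, hz, hzU⟩ := h
    exact hF.exists_grow_of_adj hy j hz (notMem_verts.1 hzU)
  · push Not at h
    have hsub : G.neighborFinset (y j) ⊆ (verts y A).erase (y j) := by
      intro z hz
      rw [mem_neighborFinset] at hz
      exact Finset.mem_erase.2 ⟨hz.ne', h z hz⟩
    have hmem : y j ∈ verts y A := by
      simp only [verts, Finset.mem_biUnion]
      exact ⟨j, by simp⟩
    have h1 := Finset.card_le_card hsub
    have h2 := Finset.card_erase_lt_of_mem hmem
    have h3 := card_verts_le y A
    rw [card_neighborFinset_eq_degree] at h1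
    omega

lemma degree_le_sum [Fintype V] [Fintype ι] [DecidableEq V] [DecidableRel G.Adj]
    (y : ι → V) (A : ι → Finset V) (v : V) :
    G.degree v ≤ ∑ i, ((G.neighborFinset v ∩ A i).card + if G.Adj v (y i) then 1 else 0) +
      (G.neighborFinset v \ verts y A).card := by
  have hsub : G.neighborFinset v ⊆ (Finset.univ.biUnion fun i ↦
      G.neighborFinset v ∩ A i ∪ if G.Adj v (y i) then {y i} else ∅) ∪
      (G.neighborFinset v \ verts y A) := by
    intro z hz
    have hz' := hz
    rw [mem_neighborFinset] at hz'
    by_cases h : z ∈ verts y A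
    · simp only [verts, Finset.mem_biUnion, Finset.mem_insert] at h
      obtain ⟨i, -, h⟩ := h
      refine Finset.mem_union_left _ (Finset.mem_biUnion.2 ⟨i, Finset.mem_univ i, ?_⟩)
      rcases h with rfl | h
      · simp [hz']
      · simp [hz', h]
    · simp [hz', h]
  rw [← card_neighborFinset_eq_degree]
  refine (Finset.card_le_card hsub).trans ((Finset.card_union_le _ _).trans ?_)
  gcongr
  refine Finset.card_biUnion_le.trans (Finset.sum_le_sum fun i _ ↦ ?_)
  refine (Finset.card_union_le _ _).trans ?_
  gcongr
  split_ifs <;> simp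

/-- An incomplete star forest whose prospective centers have large degree can be enlarged by
one leaf, possibly after exchanging some vertices. -/
lemma exists_grow [Fintype V] [Fintype ι] [DecidableEq V] [DecidableEq ι] [DecidableRel G.Adj]
    (hF : G.IsStarForest y A) {N : Finset V} (hy : ∀ i, y i ∈ N) {a : ι → ℕ} (ha : ∀ i, 0 < a i)
    (hN : Fintype.card ι + ∑ i, a i ≤ N.card) (hd : ∀ v ∈ N, ∑ i, a i ≤ G.degree v)
    (hA : ∀ i, (A i).card ≤ a i) (j : ι) (hj : (A j).card < a j) :
    ∃ (y' : ι → V) (A' : ι → Finset V), G.IsStarForest y' A' ∧ (∀ i, y' i ∈ N) ∧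
      ∀ i, (A' i).card = (A i).card + if i = j then 1 else 0 := by
  by_contra hcon
  obtain ⟨w, hwN, hw⟩ : ∃ w ∈ N, w ∉ verts y A := by
    apply Finset.exists_mem_notMem_of_card_lt_card
    have h1 := card_verts_le y A
    have h2 : ∑ i, (A i).card < ∑ i, a i :=
      Finset.sum_lt_sum (fun i _ ↦ hA i) ⟨j, Finset.mem_univ j, hj⟩
    omega
  have hw' := notMem_verts.1 hw
  have hjU : ∀ z, G.Adj (y j) z → z ∈ verts y A := by
    intro z hz
    by_contra hzU
    exact hcon (hF.exists_grow_of_adj hy j hz (notMem_verts.1 hzU))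
  have hjw : ¬ G.Adj (y j) w := fun h ↦ hw (hjU w h)
  have hy_ne : ∀ i k, k ≠ i → y i ≠ y k := fun i k hk h ↦ hk (hF.center_injective h).symm
  -- The vertex `w` sees few vertices among the `i`-th leaves and the uncovered vertices.
  have hmem : ∀ i z, z ∈ G.neighborFinset w ∩ A i ∪ (G.neighborFinset w \ verts y A) →
      G.Adj w z ∧ ∀ k, k ≠ i → z ≠ y k ∧ z ∉ A k := by
    intro i z hz
    rcases Finset.mem_union.1 hz with hz | hz
    · obtain ⟨h1, h2⟩ := Finset.mem_inter.1 hz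
      refine ⟨(mem_neighborFinset ..).1 h1, fun k hk ↦ ⟨?_, fun h ↦ hk (hF.eq_of_mem k i z h h2)⟩⟩
      rintro rfl
      exact hF.center_notMem k i h2
    · obtain ⟨h1, h2⟩ := Finset.mem_sdiff.1 hz
      exact ⟨(mem_neighborFinset ..).1 h1, fun k _ ↦ notMem_verts.1 h2 k⟩
  have hcard : ∀ i, (G.neighborFinset w ∩ A i ∪ (G.neighborFinset w \ verts y A)).card =
      (G.neighborFinset w ∩ A i).card + (G.neighborFinset w \ verts y A).card := by
    intro i
    apply Finset.card_union_of_disjoint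
    rw [Finset.disjoint_left]
    intro z hz hz'
    exact (notMem_verts.1 (Finset.mem_sdiff.1 hz').2 i).2 (Finset.mem_inter.1 hz).2
  have hstar : (G.neighborFinset w ∩ A j).card + (G.neighborFinset w \ verts y A).card ≤
      (A j).card := by
    by_contra! h
    rw [← hcard] at h
    obtain ⟨B, hB, hBcard⟩ := Finset.exists_subset_card_eq (Nat.succ_le_of_lt h)
    refine hcon ⟨_, _, hF.replace j w B (fun k _ ↦ hw' k) (fun z hz ↦ hmem j z (hB hz)), ?_, ?_⟩
    · intro i
      by_cases hi : i = j <;> simp [hi, hwN, hy]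
    · intro i
      by_cases hi : i = j <;> simp [hi, hBcard]
  have hcenter : ∀ i, i ≠ j → G.Adj (y j) (y i) →
      (G.neighborFinset w ∩ A i).card + (G.neighborFinset w \ verts y A).card < (A i).card := by
    intro i hij hadj
    by_contra! h
    rw [← hcard] at h
    obtain ⟨B, hB, hBcard⟩ := Finset.exists_subset_card_eq h
    have hF' := hF.replace i w B (fun k _ ↦ hw' k) (fun z hz ↦ hmem i z (hB hz))
    have hyB : y i ∉ B := by
      intro h
      rcases Finset.mem_union.1 (hB h) with h | h
      · exact hF.center_notMem i i (Finset.mem_inter.1 h).2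
      · exact (notMem_verts.1 (Finset.mem_sdiff.1 h).2 i).1 rfl
    obtain ⟨y', A', h1, h2, h3⟩ := hF'.exists_grow_of_adj (N := N) (z := y i)
      (fun k ↦ by by_cases hk : k = i <;> simp [hk, hwN, hy]) j
      (by simpa [hij.symm] using hadj) (fun k ↦ by
        by_cases hk : k = i
        · subst hk
          simpa [hyB] using (hw' k).1.symm
        · simpa [hk, hF.center_notMem] using hy_ne i k hk)
    refine hcon ⟨y', A', h1, h2, fun k ↦ ?_⟩
    rw [h3]
    by_cases hk : k = i <;> simp [hk, hBcard]
  have hleaf : ∀ i, i ≠ j → G.Adj w (y i) → G.neighborFinset (y j) ∩ A i = ∅ := by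
    intro i hij hadj
    by_contra! h
    obtain ⟨z, hz⟩ := h
    obtain ⟨hz, hzA⟩ := Finset.mem_inter.1 hz
    rw [mem_neighborFinset] at hz
    have hF' := hF.replace i (y i) (insert w ((A i).erase z))
      (fun k hk ↦ ⟨hy_ne i k hk, hF.center_notMem i k⟩) (by
        intro x hx
        rcases Finset.mem_insert.1 hx with rfl | hx
        · exact ⟨hadj.symm, fun k _ ↦ hw' k⟩
        · have hx := Finset.mem_of_mem_erase hx
          refine ⟨hF.adj i x hx, fun k hk ↦ ⟨?_, fun h ↦ hk (hF.eq_of_mem k i x h hx)⟩⟩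
          rintro rfl
          exact hF.center_notMem k i hx)
    have hzw : z ≠ w := by
      rintro rfl
      exact (hw' i).2 hzA
    obtain ⟨y', A', h1, h2, h3⟩ := hF'.exists_grow_of_adj (N := N) (z := z)
      (fun k ↦ by by_cases hk : k = i <;> simp [hk, hy]) j
      (by simpa using hz) (fun k ↦ by
        by_cases hk : k = i
        · subst hk
          simpa [hzw] using (hF.adj k z hzA).ne'
        · simp only [Function.update_of_ne hk]
          refine ⟨?_, fun h ↦ hk (hF.eq_of_mem k i z h hzA)⟩
          rintro rfl
          exact hF.center_notMem k i hzA)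
    refine hcon ⟨y', A', h1, h2, fun k ↦ ?_⟩
    rw [h3]
    by_cases hk : k = i
    · subst hk
      have hpos : 0 < (A k).card := Finset.card_pos.2 ⟨z, hzA⟩
      have : w ∉ (A k).erase z := fun h ↦ (hw' k).2 (Finset.mem_of_mem_erase h)
      simp [hij, Finset.card_insert_of_notMem this, Finset.card_erase_of_mem hzA]
      omega
    · simp [hk]
  have hsum := add_le_add (degree_le_sum (G := G) y A (y j)) (degree_le_sum (G := G) y A w)
  have hempty : G.neighborFinset (y j) \ verts y A = ∅ := by
    rw [Finset.sdiff_eq_empty_iff_subset]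
    exact fun z hz ↦ hjU z ((mem_neighborFinset ..).1 hz)
  have hother : ∀ i, i ≠ j →
      ((G.neighborFinset (y j) ∩ A i).card + if G.Adj (y j) (y i) then 1 else 0) +
      ((G.neighborFinset w ∩ A i).card + if G.Adj w (y i) then 1 else 0) ≤ 2 * a i := by
    intro i hij
    have h1 := hcenter i hij
    have h2 := hleaf i hij
    have h3 : (G.neighborFinset (y j) ∩ A i).card ≤ (A i).card :=
      Finset.card_le_card Finset.inter_subset_right
    have h4 : (G.neighborFinset w ∩ A i).card ≤ (A i).card :=
      Finset.card_le_card Finset.inter_subset_right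
    have h5 := hA i
    have h6 := ha i
    split_ifs with h7 h8 h8
    · have := h1 h7
      simp only [h2 h8, Finset.card_empty]
      omega
    · have := h1 h7
      omega
    · simp only [h2 h8, Finset.card_empty]
      omega
    · omega
  have hself : (G.neighborFinset (y j) ∩ A j).card ≤ (A j).card :=
    Finset.card_le_card Finset.inter_subset_right
  have h1 := hd _ (hy j)
  have h2 := hd w hwN
  rw [hempty, Finset.card_empty, add_zero, ← Finset.add_sum_erase _ _ (Finset.mem_univ j),
    ← Finset.add_sum_erase _ _ (Finset.mem_univ j)] at hsum
  have h3 := Finset.sum_le_sum fun i (hi : i ∈ Finset.univ.erase j) ↦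
    hother i (Finset.ne_of_mem_erase hi)
  rw [Finset.sum_add_distrib, ← Finset.mul_sum] at h3
  rw [← Finset.add_sum_erase _ _ (Finset.mem_univ j)] at h1 h2
  have h4 : ¬ G.Adj w (y j) := fun h ↦ hjw h.symm
  simp only [G.irrefl, h4, if_false] at hsum
  omega

/-- A graph with sufficiently many vertices `v ∈ N` of degree at least `∑ i, a i` contains
vertex-disjoint stars with centers in `N` and leaf numbers `a`. -/
theorem exists_of_le_degree [Fintype V] [Fintype ι] [DecidableRel G.Adj] (N : Finset V)
    {a : ι → ℕ} (ha : ∀ i, 0 < a i) (hN : Fintype.card ι + ∑ i, a i ≤ N.card)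
    (hd : ∀ v ∈ N, ∑ i, a i ≤ G.degree v) :
    ∃ (y : ι → V) (A : ι → Finset V), G.IsStarForest y A ∧ (∀ i, y i ∈ N) ∧
      ∀ i, (A i).card = a i := by
  classical
  exact exists_of_grow N a (by omega) fun y A hF hy hA j hj ↦ hF.exists_grow hy ha hN hd hA j hj

/-- The greedy construction of a star forest whose centers have very large degree. -/
theorem exists_of_card_add_sum_le_degree [Fintype V] [Fintype ι] [DecidableRel G.Adj]
    (N : Finset V) (a : ι → ℕ) (hN : Fintype.card ι ≤ N.card)
    (hd : ∀ v ∈ N, Fintype.card ι + ∑ i, a i ≤ G.degree v + 1) :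
    ∃ (y : ι → V) (A : ι → Finset V), G.IsStarForest y A ∧ (∀ i, y i ∈ N) ∧
      ∀ i, (A i).card = a i := by
  classical
  refine exists_of_grow N a hN fun y A hF hy hA j hj ↦ hF.exists_grow_of_le_degree hy j ?_
  have h1 := hd _ (hy j)
  have h2 : ∑ i, (A i).card < ∑ i, a i :=
    Finset.sum_lt_sum (fun i _ ↦ hA i) ⟨j, Finset.mem_univ j, hj⟩
  omega

end IsStarForest

lemma degree_le_degree_deleteIncidenceSet_add_one {V : Type*} [Fintype V] (G : SimpleGraph V)
    [DecidableRel G.Adj] (x v : V) [DecidableRel (G.deleteIncidenceSet x).Adj] (hv : v ≠ x) :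
    G.degree v ≤ (G.deleteIncidenceSet x).degree v + 1 := by
  classical
  rw [← card_neighborFinset_eq_degree, ← card_neighborFinset_eq_degree]
  refine (Finset.card_le_card (t := insert x ((G.deleteIncidenceSet x).neighborFinset v)) ?_).trans
    (Finset.card_insert_le _ _)
  intro z hz
  by_cases h : z = x <;> simp_all [deleteIncidenceSet_adj]

/-- If the average degree of `G` exceeds `r + q - 1`, then either some vertex has `r` neighbors of
degree at least `r + q`, or some vertex has `r + q` neighbors of degree greater than `q`. -/
lemma exists_many_neighbors_of_lt_sum_degree {V : Type*} [Fintype V] (G : SimpleGraph V)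
    [DecidableRel G.Adj] {r q : ℕ} (hr : 0 < r)
    (h : (r + q - 1) * Fintype.card V < ∑ v, G.degree v) :
    (∃ x, r ≤ ((G.neighborFinset x).filter fun y ↦ r + q ≤ G.degree y).card) ∨
      ∃ x, r + q ≤ ((G.neighborFinset x).filter fun y ↦ q < G.degree y).card := by
  classical
  by_contra! hcon
  obtain ⟨hhigh, hgood⟩ := hcon
  let H : Finset V := Finset.univ.filter fun v ↦ r + q ≤ G.degree v
  let B : Finset V := Finset.univ.filter fun v ↦ G.degree v ≤ q
  have hH : ∀ v, B.bipartiteAbove G.Adj v =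
      (G.neighborFinset v).filter fun y ↦ ¬ q < G.degree y := by
    intro v
    ext z
    simp [B, Finset.mem_bipartiteAbove, and_comm]
  have hB : ∀ v, H.bipartiteBelow G.Adj v =
      (G.neighborFinset v).filter fun y ↦ r + q ≤ G.degree y := by
    intro v
    ext z
    simp [H, Finset.mem_bipartiteBelow, and_comm, G.adj_comm]
  have hcount := Finset.sum_card_bipartiteAbove_eq_sum_card_bipartiteBelow (s := H) (t := B) G.Adj
  have hpoint : ∀ v, G.degree v + (if v ∈ B then (H.bipartiteBelow G.Adj v).card else 0) ≤
      (r + q - 1) + if v ∈ H then (B.bipartiteAbove G.Adj v).card else 0 := by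
    intro v
    rw [hH, hB]
    have h1 := hhigh v
    have h2 := hgood v
    have h3 := Finset.card_filter_add_card_filter_not (s := G.neighborFinset v)
      fun y ↦ q < G.degree y
    rw [card_neighborFinset_eq_degree] at h3
    simp only [H, B, Finset.mem_filter, Finset.mem_univ, true_and]
    split_ifs <;> omega
  have hsum := Finset.sum_le_sum fun v (_ : v ∈ Finset.univ) ↦ hpoint v
  rw [Finset.sum_add_distrib, Finset.sum_add_distrib, Finset.sum_ite_mem, Finset.sum_ite_mem,
    Finset.univ_inter, Finset.univ_inter, hcount] at hsum
  simp only [Finset.sum_const, Finset.card_univ, smul_eq_mul] at hsum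
  rw [mul_comm] at h
  omega

/-- The union of a vertex `x` with disjoint stars whose centers are adjacent to `x`. -/
lemma exists_rooted_isStarForest {V ι : Type*} [Fintype V] [Fintype ι] [Nonempty ι]
    (G : SimpleGraph V) [DecidableRel G.Adj] (a : ι → ℕ)
    (h : (Fintype.card ι + ∑ i, a i - 1) * Fintype.card V < ∑ v, G.degree v) :
    ∃ (x : V) (y : ι → V) (A : ι → Finset V), G.IsStarForest y A ∧ (∀ i, G.Adj x (y i)) ∧
      (∀ i, x ∉ A i) ∧ ∀ i, (A i).card = a i := by
  classical
  have hleaf : ∀ {κ : Type _} {x : V} {y : κ → V} {A : κ → Finset V},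
      (G.deleteIncidenceSet x).IsStarForest y A → ∀ i, x ∉ A i := fun hF i hx ↦
    (deleteIncidenceSet_adj.1 (hF.adj i _ hx)).2.2 rfl
  have hanti : ∀ {κ : Type _} {x : V} {y : κ → V} {A : κ → Finset V},
      (G.deleteIncidenceSet x).IsStarForest y A → G.IsStarForest y A := fun hF ↦
    ⟨fun i z hz ↦ G.deleteIncidenceSet_le _ (hF.adj i z hz), hF.2, hF.3, hF.4⟩
  rcases G.exists_many_neighbors_of_lt_sum_degree Fintype.card_pos h with ⟨x, hx⟩ | ⟨x, hx⟩
  · obtain ⟨y, A, hF, hy, hA⟩ := IsStarForest.exists_of_card_add_sum_le_degree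
      (G := G.deleteIncidenceSet x) _ a hx (by
        intro v hv
        simp only [Finset.mem_filter, mem_neighborFinset] at hv
        exact hv.2.trans (G.degree_le_degree_deleteIncidenceSet_add_one x v hv.1.ne'))
    refine ⟨x, y, A, hanti hF, fun i ↦ ?_, hleaf hF, hA⟩
    simpa using (Finset.mem_filter.1 (hy i)).1
  · have hsum : ∑ i : {i // 0 < a i}, a i = ∑ i, a i := by
      rw [← Fintype.sum_subtype_add_sum_subtype (fun i ↦ 0 < a i) a, left_eq_add]
      exact Finset.sum_eq_zero fun i _ ↦ Nat.eq_zero_of_not_pos i.2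
    have hcard := Fintype.card_subtype_compl fun i ↦ 0 < a i
    have hcard_le := Fintype.card_subtype_le fun i ↦ 0 < a i
    obtain ⟨y, A, hF, hy, hA⟩ := IsStarForest.exists_of_le_degree
      (G := G.deleteIncidenceSet x) (ι := {i // 0 < a i}) _ (a := fun i ↦ a i) (fun i ↦ i.2)
      (hx.trans' (by omega)) (by
        intro v hv
        simp only [Finset.mem_filter, mem_neighborFinset] at hv
        have := G.degree_le_degree_deleteIncidenceSet_add_one x v hv.1.ne'
        omega)
    have hxy : ∀ i, G.Adj x (y i) := fun i ↦ by
      simpa using (Finset.mem_filter.1 (hy i)).1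
    obtain ⟨e⟩ : Nonempty ({i // ¬ 0 < a i} ↪
        (G.neighborFinset x \ IsStarForest.verts y A : Finset V)) := by
      apply Function.Embedding.nonempty_of_card_le
      have h1 := IsStarForest.card_verts_le y A
      have h2 := Finset.le_card_sdiff (IsStarForest.verts y A) (G.neighborFinset x)
      have h3 := hx.trans (Finset.card_filter_le _ _)
      simp only [hA, hsum] at h1
      rw [Fintype.card_coe]
      omega
    have he : ∀ i, G.Adj x (e i) ∧ ∀ k, (e i : V) ≠ y k ∧ (e i : V) ∉ A k := fun i ↦ by
      have := Finset.mem_sdiff.1 (e i).2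
      exact ⟨by simpa using this.1, IsStarForest.notMem_verts.1 this.2⟩
    have hinj : ∀ i j, (e i : V) = e j → i = j := fun i j h ↦ e.injective (Subtype.ext h)
    refine ⟨x, fun i ↦ if hi : 0 < a i then y ⟨i, hi⟩ else e ⟨i, hi⟩,
      fun i ↦ if hi : 0 < a i then A ⟨i, hi⟩ else ∅, ⟨?_, ?_, ?_, ?_⟩, ?_, ?_, ?_⟩
    · intro i z hz
      by_cases hi : 0 < a i
      · simp only [hi, dif_pos] at hz ⊢
        exact (hanti hF).adj _ _ hz
      · simp [hi] at hz
    · intro i j hij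
      by_cases hi : 0 < a i <;> by_cases hj : 0 < a j <;>
        simp only [hi, hj, dif_pos, dif_neg, not_false_eq_true] at hij
      · simpa using hF.center_injective hij
      · exact absurd hij.symm ((he _).2 _).1
      · exact absurd hij ((he _).2 _).1
      · simpa using hinj _ _ hij
    · intro i j
      by_cases hi : 0 < a i <;> by_cases hj : 0 < a j <;> simp [hi, hj, hF.center_notMem, he]
    · intro i j z hi hj
      by_cases hi' : 0 < a i <;> by_cases hj' : 0 < a j <;> simp [hi', hj'] at hi hj
      simpa using hF.eq_of_mem _ _ z hi hj
    · intro i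
      by_cases hi : 0 < a i <;> simp [hi, hxy, he]
    · intro i
      by_cases hi : 0 < a i <;> simp [hi, hleaf hF]
    · intro i
      by_cases hi : 0 < a i
      · simp [hi, hA]
      · simp only [hi, dif_neg, not_false_eq_true, Finset.card_empty]
        omega

/-- Every vertex at distance two from a vertex of an acyclic graph has a unique parent. -/
lemma IsAcyclic.eq_of_adj_of_adj {W : Type*} {T : SimpleGraph W} (hT : T.IsAcyclic) {c i j w : W}
    (hi : T.Adj c i) (hj : T.Adj c j) (hiw : T.Adj i w) (hjw : T.Adj j w) (hw : w ≠ c) : i = j := by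
  have := (hT.subsingleton_path c w).elim
    ⟨.cons hi (.cons hiw .nil), by simp [hi.ne, hiw.ne, hw.symm]⟩
    ⟨.cons hj (.cons hjw .nil), by simp [hj.ne, hjw.ne, hw.symm]⟩
  simp only [Subtype.mk.injEq, Walk.cons.injEq] at this
  exact this.1

/-- A tree of radius at most two embeds into any graph whose average degree exceeds the order of
the tree minus two. -/
lemma IsTree.exists_injective_hom_of_forall_dist_le_two {V W : Type*} [Fintype V] [Fintype W]
    (G : SimpleGraph V) [DecidableRel G.Adj] {T : SimpleGraph W} (hT : T.IsTree) {c : W}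
    (hc : ∀ w, T.dist c w ≤ 2) (hcard : 2 ≤ Fintype.card W)
    (h : (Fintype.card W - 2) * Fintype.card V < ∑ v, G.degree v) :
    ∃ f : T →g G, Function.Injective f := by
  classical
  let C : {i // T.Adj c i} → Finset W := fun i ↦ (T.neighborFinset i).erase c
  have hCmem : ∀ i w, w ∈ C i ↔ w ≠ c ∧ T.Adj i w := by simp [C]
  have hCuniq : ∀ i j w, w ∈ C i → w ∈ C j → i = j := fun i j w hi hj ↦ by
    rw [hCmem] at hi hj
    exact Subtype.ext (hT.isAcyclic.eq_of_adj_of_adj i.2 j.2 hi.2 hj.2 hi.1)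
  have hClevel : ∀ i, ∀ w ∈ C i, ¬ T.Adj c w := fun i w hi hw ↦ by
    rw [hCmem] at hi
    have h1 := hT.dist_ne_of_adj c hi.2
    rw [dist_eq_one_iff_adj.2 i.2, dist_eq_one_iff_adj.2 hw] at h1
    exact h1 rfl
  have hTF : T.IsStarForest (fun i : {i // T.Adj c i} ↦ (i : W)) C :=
    ⟨fun i w hw ↦ ((hCmem i w).1 hw).2, Subtype.val_injective,
      fun i j hi ↦ hClevel j _ hi i.2, hCuniq⟩
  have hparent : ∀ w, w ≠ c → ¬ T.Adj c w → ∃ i, w ∈ C i := fun w hw hcw ↦ by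
    obtain ⟨p, hp⟩ := hT.connected.exists_walk_length_eq_dist c w
    have hp2 := hp.trans_le (hc w)
    match p, hp2 with
    | .nil, _ => exact absurd rfl hw
    | .cons h .nil, _ => exact absurd h hcw
    | .cons h (.cons h' .nil), _ => exact ⟨⟨_, h⟩, (hCmem _ _).2 ⟨hw, h'⟩⟩
    | .cons _ (.cons _ (.cons _ _)), hp2 => simp at hp2
  have hle : Fintype.card {i // T.Adj c i} + ∑ i, (C i).card ≤ Fintype.card W - 1 := by
    rw [← Finset.card_univ (α := W), ← Finset.card_erase_of_mem (Finset.mem_univ c)]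
    calc
      _ = ∑ i : {i // T.Adj c i}, (insert (i : W) (C i)).card := by
        rw [← Finset.card_univ, Finset.card_eq_sum_ones, ← Finset.sum_add_distrib]
        refine Finset.sum_congr rfl fun i _ ↦ ?_
        rw [Finset.card_insert_of_notMem (hTF.center_notMem i i), add_comm]
      _ = (Finset.univ.biUnion fun i : {i // T.Adj c i} ↦ insert (i : W) (C i)).card := by
        refine (Finset.card_biUnion fun i _ j _ hij ↦ Finset.disjoint_left.2 fun w hi hj ↦ ?_).symm
        rw [Finset.mem_insert] at hi hj
        rcases hi with rfl | hi <;> rcases hj with hj | hj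
        · exact hij (Subtype.ext hj)
        · exact hTF.center_notMem i j hj
        · exact hTF.center_notMem j i (hj ▸ hi)
        · exact hij (hCuniq i j w hi hj)
      _ ≤ _ := by
        refine Finset.card_le_card fun w hw ↦ Finset.mem_erase.2 ⟨?_, Finset.mem_univ w⟩
        obtain ⟨i, -, hi⟩ := Finset.mem_biUnion.1 hw
        rcases Finset.mem_insert.1 hi with rfl | hi
        · exact i.2.ne'
        · exact ((hCmem i w).1 hi).1
  have : Nonempty {i // T.Adj c i} := by
    have : Nontrivial W := Fintype.one_lt_card_iff_nontrivial.1 hcard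
    obtain ⟨i, hi⟩ := hT.connected.preconnected.exists_adj_of_nontrivial c
    exact ⟨⟨i, hi⟩⟩
  obtain ⟨x, y, A, hF, hxy, hxA, hA⟩ := G.exists_rooted_isStarForest (fun i ↦ (C i).card)
    (lt_of_le_of_lt (Nat.mul_le_mul_right _ (by omega)) h)
  let e : ∀ i, C i ≃ A i := fun i ↦ Finset.equivOfCardEq (hA i).symm
  choose! par hpar using hparent
  let g : {i // T.Adj c i} → W → V := fun i w ↦ if h : w ∈ C i then e i ⟨w, h⟩ else x
  have hgA : ∀ i, ∀ w ∈ C i, g i w ∈ A i := fun i w hw ↦ by simp [g, hw]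
  have hginj : ∀ i, ∀ w ∈ C i, ∀ w' ∈ C i, g i w = g i w' → w = w' := fun i w hw w' hw' h ↦ by
    simpa [g, hw, hw', Subtype.ext_iff] using h
  let f : W → V := fun w ↦
    if w = c then x else if h : T.Adj c w then y ⟨w, h⟩ else g (par w) w
  have hfc : f c = x := by simp [f]
  have hfy : ∀ i : {i // T.Adj c i}, f i = y i := fun i ↦ by simp [f, i.2, i.2.ne']
  have hfg : ∀ i, ∀ w ∈ C i, f w = g i w := fun i w hw ↦ by
    have h1 := ((hCmem i w).1 hw).1
    have h2 := hClevel i w hw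
    simp only [f, h1, h2, if_false, dif_neg, not_false_eq_true]
    rw [hCuniq _ _ w (hpar w h1 h2) hw]
  have hdist : ∀ i, ∀ w ∈ C i, T.dist c w = 2 := fun i w hw ↦ by
    have h1 := hT.connected.pos_dist_of_ne ((hCmem i w).1 hw).1.symm
    have h2 := mt dist_eq_one_iff_adj.1 (hClevel i w hw)
    have h3 := hc w
    omega
  have hcases : ∀ w, w = c ∨ (∃ i : {i // T.Adj c i}, w = i) ∨ ∃ i, w ∈ C i := fun w ↦ by
    by_cases h1 : w = c
    · exact .inl h1
    by_cases h2 : T.Adj c w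
    · exact .inr (.inl ⟨⟨w, h2⟩, rfl⟩)
    · exact .inr (.inr ⟨_, hpar w h1 h2⟩)
  refine ⟨⟨f, fun {u v} huv ↦ ?_⟩, fun u v (huv : f u = f v) ↦ ?_⟩
  · have hne := hT.dist_ne_of_adj c huv
    rcases hcases u with rfl | ⟨i, rfl⟩ | ⟨i, hi⟩ <;>
      rcases hcases v with rfl | ⟨j, rfl⟩ | ⟨j, hj⟩
    · exact absurd huv T.irrefl
    · rw [hfc, hfy]
      exact hxy j
    · exact absurd huv (hClevel j v hj)
    · rw [hfc, hfy]
      exact (hxy i).symm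
    · rw [dist_eq_one_iff_adj.2 i.2, dist_eq_one_iff_adj.2 j.2] at hne
      exact absurd rfl hne
    · obtain rfl := hCuniq i j v ((hCmem i v).2 ⟨((hCmem j v).1 hj).1, huv⟩) hj
      rw [hfy, hfg i v hj]
      exact hF.adj i _ (hgA i v hj)
    · exact absurd huv.symm (hClevel i u hi)
    · obtain rfl := hCuniq j i u ((hCmem j u).2 ⟨((hCmem i u).1 hi).1, huv.symm⟩) hi
      rw [hfy, hfg j u hi]
      exact (hF.adj j _ (hgA j u hi)).symm
    · rw [hdist i u hi, hdist j v hj] at hne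
      exact absurd rfl hne
  · rcases hcases u with rfl | ⟨i, rfl⟩ | ⟨i, hi⟩ <;>
      rcases hcases v with rfl | ⟨j, rfl⟩ | ⟨j, hj⟩
    · rfl
    · rw [hfc, hfy] at huv
      exact absurd huv (hxy j).ne
    · rw [hfc, hfg j v hj] at huv
      exact absurd (huv ▸ hgA j v hj) (hxA j)
    · rw [hfc, hfy] at huv
      exact absurd huv.symm (hxy i).ne
    · rw [hfy, hfy] at huv
      rw [hF.center_injective huv]
    · rw [hfy, hfg j v hj] at huv
      exact absurd (huv ▸ hgA j v hj) (hF.center_notMem i j)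
    · rw [hfc, hfg i u hi] at huv
      exact absurd (huv ▸ hgA i u hi) (hxA i)
    · rw [hfy, hfg i u hi] at huv
      exact absurd (huv ▸ hgA i u hi) (hF.center_notMem j i)
    · rw [hfg i u hi, hfg j v hj] at huv
      obtain rfl := hF.eq_of_mem i j _ (hgA i u hi) (huv ▸ hgA j v hj)
      exact hginj i u hi v hj huv

end SimpleGraph

/-- Mclennan: the Erdős–Sós conjecture holds for trees of diameter at most 4. -/
theorem erdos_sos_diam_le_four {V : Type*} [Fintype V] (G : SimpleGraph V) [DecidableRel G.Adj]
    (k : ℕ) (hk : 2 ≤ k)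
    (havg : (k : ℝ) - 2 < 2 * G.edgeFinset.card / Fintype.card V) :
    ∀ (W : Type) [Fintype W] (T : SimpleGraph W), T.IsTree → Fintype.card W = k →
      T.diam ≤ 4 → ∃ f : T →g G, Function.Injective f := by
  intro W _ T hT hcard hdiam
  have := hT.connected.nonempty
  obtain ⟨c, hc⟩ := hT.exists_forall_dist_le (n := 2) fun u v ↦
    (dist_le_diam (connected_iff_ediam_ne_top.1 hT.connected)).trans hdiam
  have hk' : (2 : ℝ) ≤ k := by exact_mod_cast hk
  have hV : 0 < Fintype.card V := by
    by_contra hV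
    rw [Nat.eq_zero_of_not_pos hV, Nat.cast_zero, div_zero] at havg
    linarith
  rw [lt_div_iff₀ (by exact_mod_cast hV)] at havg
  refine IsTree.exists_injective_hom_of_forall_dist_le_two G hT hc (hcard ▸ hk) ?_
  rw [hcard, sum_degrees_eq_twice_card_edges]
  have h2 : ((k - 2 : ℕ) : ℝ) = k - 2 := by push_cast [Nat.cast_sub hk]; rfl
  rw [← h2] at havg
  exact_mod_cast havg
end
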